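/- Let h ∈ ℤ⁺. There exists a multiplicative basis A of order h for ℤ⁺ (A ∈ MB_h) such that limsup_{x→∞} A(x) · (log x)^{1-1/h} / x = h/Γ(1/h). -/

import Mathlib

open Filter Real

/-- Counting function: `A(x) = |A ∩ {1,…,⌊x⌋}|`. -/
noncomputable def cntF (A : Set ℕ) (x : ℝ) : ℕ := (A ∩ Set.Icc 1 ⌊x⌋₊).ncard

/-- Multiplicative representation function of order `h`. -/
noncomputable def mulRep (h : ℕ) (A : Set ℕ) (n : ℕ) : ℕ :=
  {f : Fin h → ℕ | (∀ i, f i ∈ A) ∧ ∏ i, f i = n}.ncard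

/-- `A` is a multiplicative basis of order `h` for `ℤ⁺`. -/
def IsMB (h : ℕ) (A : Set ℕ) : Prop := ∀ n : ℕ, 1 ≤ n → 1 ≤ mulRep h A n

/-- The Fejér kernel of bandwidth `L`. -/
noncomputable def fejer (L x : ℝ) : ℝ := L * sinc (L * x / 2) ^ 2

lemma fejer_nonneg {L : ℝ} (hL : 0 < L) (x : ℝ) : 0 ≤ fejer L x := by
  unfold fejer; positivity

lemma continuous_fejer (L : ℝ) : Continuous (fejer L) := by
  unfold fejer
  have := continuous_sinc
  fun_prop

lemma sinc_sq_le (y : ℝ) : sinc y ^ 2 ≤ 2 * (1 + y ^ 2)⁻¹ := by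
  rw [← div_eq_mul_inv, le_div_iff₀ (by positivity), mul_add, mul_one]
  have h1 : sinc y ^ 2 ≤ 1 := by
    rw [sq_le_one_iff_abs_le_one]; exact abs_le.2 ⟨neg_one_le_sinc y, sinc_le_one y⟩
  have h2 : sinc y ^ 2 * y ^ 2 ≤ 1 := by
    rcases eq_or_ne y 0 with rfl | hy
    · simp
    · rw [sinc_of_ne_zero hy, div_pow, div_mul_cancel₀ _ (by positivity)]
      exact sin_sq_le_one y
  linarith

lemma integrable_fejer {L : ℝ} (hL : 0 < L) : MeasureTheory.Integrable (fejer L) := by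
  have h0 : MeasureTheory.Integrable (fun y : ℝ => sinc y ^ 2) := by
    refine (integrable_inv_one_add_sq.const_mul 2).mono'
      (continuous_sinc.pow 2).aestronglyMeasurable ?_
    refine Eventually.of_forall fun y => ?_
    rw [Real.norm_of_nonneg (by positivity)]
    exact sinc_sq_le y
  have h1 := (h0.comp_mul_right' (R := L / 2) (by positivity)).const_mul L
  refine h1.congr (Eventually.of_forall fun x => ?_)
  simp only [fejer]
  ring_nf

lemma integral_triangle_mul_cexp {L : ℝ} (hL : 0 < L) (x : ℝ) :
    ∫ t in (-L)..L, ((1 - |t| / L : ℝ) : ℂ) * Complex.exp (t * x * Complex.I) = fejer L x := by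
  have hLc : (L : ℂ) ≠ 0 := by exact_mod_cast hL.ne'
  have hcont : Continuous fun t : ℝ =>
      ((1 - |t| / L : ℝ) : ℂ) * Complex.exp (t * x * Complex.I) := by
    fun_prop
  rcases eq_or_ne x 0 with rfl | hx
  · simp only [Complex.ofReal_zero, mul_zero, zero_mul, Complex.exp_zero, mul_one, fejer, zero_div,
      sinc_zero, one_pow]
    rw [intervalIntegral.integral_ofReal]
    congr 1
    have hc : Continuous fun t : ℝ => 1 - |t| / L := by fun_prop
    rw [← intervalIntegral.integral_add_adjacent_intervals (b := 0) (hc.intervalIntegrable _ _)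
      (hc.intervalIntegrable _ _)]
    have e1 : ∫ t in (-L)..0, (1 - |t| / L) = ∫ t in (-L)..0, (1 + t / L) := by
      refine intervalIntegral.integral_congr fun t ht => ?_
      rw [Set.uIcc_of_le (by linarith)] at ht
      simp only [abs_of_nonpos ht.2]; ring
    have e2 : ∫ t in (0)..L, (1 - |t| / L) = ∫ t in (0)..L, (1 - t / L) := by
      refine intervalIntegral.integral_congr fun t ht => ?_
      rw [Set.uIcc_of_le hL.le] at ht
      simp only [abs_of_nonneg ht.1]
    rw [e1, e2, intervalIntegral.integral_add (by simp)
      ((by fun_prop : Continuous fun t : ℝ => t / L).intervalIntegrable _ _),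
      intervalIntegral.integral_sub (by simp)
      ((by fun_prop : Continuous fun t : ℝ => t / L).intervalIntegrable _ _)]
    simp only [intervalIntegral.integral_div, integral_id, intervalIntegral.integral_const]
    simp
    field_simp
    ring
  · have hxc : (x : ℂ) ≠ 0 := by exact_mod_cast hx
    rw [← intervalIntegral.integral_add_adjacent_intervals (b := 0) (hcont.intervalIntegrable _ _)
      (hcont.intervalIntegrable _ _)]
    have key : ∀ σ : ℂ, ∀ t : ℝ, HasDerivAt (fun t : ℝ =>
        (1 + σ * t / L) * (Complex.exp (t * x * Complex.I) / (x * Complex.I))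
          - σ / L * (Complex.exp (t * x * Complex.I) / (x * Complex.I) ^ 2))
        ((1 + σ * t / L) * Complex.exp (t * x * Complex.I)) t := by
      intro σ t
      have h1 : HasDerivAt (fun t : ℝ => (t : ℂ)) 1 t := Complex.ofRealCLM.hasDerivAt
      have h2 : HasDerivAt (fun t : ℝ => Complex.exp (t * x * Complex.I))
          (Complex.exp (t * x * Complex.I) * (1 * x * Complex.I)) t :=
        ((h1.mul_const _).mul_const _).cexp
      have h3 := ((((h1.const_mul σ).div_const (L : ℂ)).const_add 1).mul
        (h2.div_const (x * Complex.I))).sub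
        ((h2.div_const ((x * Complex.I) ^ 2)).const_mul (σ / L))
      refine h3.congr_deriv ?_
      field_simp
      ring
    have e1 : ∫ t in (-L)..0, ((1 - |t| / L : ℝ) : ℂ) * Complex.exp (t * x * Complex.I)
        = ∫ t in (-L)..0, (1 + 1 * (t : ℂ) / L) * Complex.exp (t * x * Complex.I) := by
      refine intervalIntegral.integral_congr fun t ht => ?_
      rw [Set.uIcc_of_le (by linarith)] at ht
      simp only [abs_of_nonpos ht.2]; push_cast; ring
    have e2 : ∫ t in (0)..L, ((1 - |t| / L : ℝ) : ℂ) * Complex.exp (t * x * Complex.I)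
        = ∫ t in (0)..L, (1 + (-1) * (t : ℂ) / L) * Complex.exp (t * x * Complex.I) := by
      refine intervalIntegral.integral_congr fun t ht => ?_
      rw [Set.uIcc_of_le hL.le] at ht
      simp only [abs_of_nonneg ht.1]; push_cast; ring
    rw [e1, e2, intervalIntegral.integral_eq_sub_of_hasDerivAt (fun t _ => key 1 t)
      ((by fun_prop : Continuous _).intervalIntegrable _ _),
      intervalIntegral.integral_eq_sub_of_hasDerivAt (fun t _ => key (-1) t)
      ((by fun_prop : Continuous _).intervalIntegrable _ _)]
    have hs : (fejer L x : ℂ) = (2 - 2 * Complex.cos (L * x)) / (L * x ^ 2) := by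
      rw [fejer, sinc_of_ne_zero (by positivity)]
      have : cos (L * x) = 1 - 2 * sin (L * x / 2) ^ 2 := by
        rw [← cos_sq_add_sin_sq (L * x / 2), show L * x = 2 * (L * x / 2) by ring, cos_two_mul]
        have := cos_sq_add_sin_sq (L * x / 2)
        ring_nf at this ⊢
        linarith
      have h2 : Complex.cos (L * x) = ((cos (L * x) : ℝ) : ℂ) := by push_cast; rfl
      rw [h2, this]
      push_cast
      field_simp
      ring
    rw [hs, Complex.cos]
    have hI : Complex.I ^ 2 = -1 := Complex.I_sq
    have h0 : ((0 : ℝ) : ℂ) * x * Complex.I = 0 := by simp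
    have hn : ((-L : ℝ) : ℂ) * x * Complex.I = -(L * x) * Complex.I := by push_cast; ring
    rw [h0, hn, mul_pow, hI]
    push_cast
    simp only [Complex.exp_zero]
    field_simp
    ring

section Tauberian
open MeasureTheory Set Topology

variable {f : ℝ → ℝ} {B : ℝ} {G : ℂ → ℂ} {L : ℝ}

lemma integral_triangle_laplace (hfm : Measurable f) (hfB : ∀ v, |f v| ≤ B) (hL : 0 < L)
    (hG : ∀ s : ℂ, 0 < s.re → ∫ v in Ioi (0 : ℝ), (f v : ℂ) * Complex.exp (-s * v) = G s)
    (u : ℝ) {ε : ℝ} (hε : 0 < ε) :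
    ∫ t in (-L)..L, ((1 - |t| / L : ℝ) : ℂ) * Complex.exp (t * u * Complex.I)
        * G (ε + t * Complex.I)
      = ((∫ v in Ioi (0 : ℝ), f v * exp (-ε * v) * fejer L (u - v) : ℝ) : ℂ) := by
  have e1 : ∀ t : ℝ, ((1 - |t| / L : ℝ) : ℂ) * Complex.exp (t * u * Complex.I)
        * G (ε + t * Complex.I) = ∫ v in Ioi (0 : ℝ), ((1 - |t| / L : ℝ) : ℂ) *
          Complex.exp (t * u * Complex.I) *
          ((f v : ℂ) * Complex.exp (-(ε + t * Complex.I) * v)) := by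
    intro t
    rw [← hG _ (by simpa using hε), integral_const_mul]
  simp_rw [e1]
  rw [intervalIntegral.integral_of_le (by linarith), integral_integral_swap]
  · rw [← integral_complex_ofReal]
    refine setIntegral_congr_fun measurableSet_Ioi fun v hv => ?_
    have e2 : ∀ t : ℝ, ((1 - |t| / L : ℝ) : ℂ) * Complex.exp (t * u * Complex.I) *
          ((f v : ℂ) * Complex.exp (-(ε + t * Complex.I) * v)) =
        ((f v * exp (-ε * v) : ℝ) : ℂ) * (((1 - |t| / L : ℝ) : ℂ) *
          Complex.exp (t * (u - v : ℝ) * Complex.I)) := by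
      intro t
      have : Complex.exp (t * u * Complex.I) * Complex.exp (-(ε + t * Complex.I) * v)
          = Complex.exp (-ε * v) * Complex.exp (t * (u - v : ℝ) * Complex.I) := by
        rw [← Complex.exp_add, ← Complex.exp_add]
        congr 1
        push_cast; ring
      push_cast at this ⊢
      linear_combination ((1 - ((|t| : ℝ) : ℂ) / L) * f v) * this
    simp only [e2]
    rw [integral_const_mul, ← intervalIntegral.integral_of_le (by linarith),
      integral_triangle_mul_cexp hL]
    push_cast; ring
  · have hd : Integrable (fun z : ℝ × ℝ => (1 : ℝ) * (B * exp (-ε * z.2)))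
        ((volume.restrict (Ioc (-L) L)).prod (volume.restrict (Ioi 0))) := by
      refine Integrable.mul_prod (f := fun _ => (1 : ℝ)) (g := fun v => B * exp (-ε * v)) ?_ ?_
      · simp
      · exact (integrableOn_exp_mul_Ioi (by linarith) 0).const_mul B
    refine hd.mono' ?_ ?_
    · refine Measurable.aestronglyMeasurable ?_
      unfold Function.uncurry
      fun_prop
    · rw [Measure.prod_restrict]
      refine (ae_restrict_iff' (measurableSet_Ioc.prod measurableSet_Ioi)).2
        (Eventually.of_forall fun z hz => ?_)
      obtain ⟨h1, h2⟩ := hz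
      simp only [Function.uncurry, norm_mul, Complex.norm_exp, Complex.norm_real]
      have ht : |z.1| ≤ L := abs_le.2 ⟨h1.1.le, h1.2⟩
      have : |1 - |z.1| / L| ≤ 1 := by
        rw [abs_le]
        have h3 : |z.1| / L ≤ 1 := (div_le_one hL).2 ht
        have h4 : 0 ≤ |z.1| / L := by positivity
        constructor <;> linarith
      simp only [Real.norm_eq_abs]
      have e3 : (z.1 * u * Complex.I : ℂ).re = 0 := by simp
      have e4 : (-(ε + z.1 * Complex.I) * z.2 : ℂ).re = -ε * z.2 := by simp
      rw [e3, e4, exp_zero, mul_one]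
      gcongr
      exact hfB _

lemma integral_triangle_laplace_zero (hfm : Measurable f) (hfB : ∀ v, |f v| ≤ B) (hL : 0 < L)
    (hG : ∀ s : ℂ, 0 < s.re → ∫ v in Ioi (0 : ℝ), (f v : ℂ) * Complex.exp (-s * v) = G s)
    (hGc : ContinuousOn G {s | 0 ≤ s.re}) (u : ℝ) :
    ∫ t in (-L)..L, ((1 - |t| / L : ℝ) : ℂ) * Complex.exp (t * u * Complex.I)
        * G (t * Complex.I)
      = ((∫ v in Ioi (0 : ℝ), f v * fejer L (u - v) : ℝ) : ℂ) := by
  have hB : 0 ≤ B := (abs_nonneg _).trans (hfB 0)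
  have hcomp : IsCompact ((fun z : ℝ × ℝ => (z.1 + z.2 * Complex.I : ℂ)) ''
      (Icc (0 : ℝ) 1 ×ˢ Icc (-L) L)) :=
    (isCompact_Icc.prod isCompact_Icc).image (by fun_prop)
  obtain ⟨C, hC⟩ := hcomp.exists_bound_of_continuousOn (f := G) (hGc.mono (by
    rintro _ ⟨z, hz, rfl⟩
    simpa using hz.1.1))
  have hline : ∀ ε : ℝ, 0 ≤ ε → Continuous fun t : ℝ => G (ε + t * Complex.I) := by
    intro ε hε
    refine hGc.comp_continuous (by fun_prop) fun t => ?_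
    simpa using hε
  have l1 : Tendsto (fun ε : ℝ => ∫ t in (-L)..L, ((1 - |t| / L : ℝ) : ℂ) *
      Complex.exp (t * u * Complex.I) * G (ε + t * Complex.I)) (𝓝[>] 0)
      (𝓝 (∫ t in (-L)..L, ((1 - |t| / L : ℝ) : ℂ) * Complex.exp (t * u * Complex.I)
        * G (t * Complex.I))) := by
    refine intervalIntegral.tendsto_integral_filter_of_dominated_convergence (fun _ => C) ?_ ?_
      (by simp) ?_
    · filter_upwards [self_mem_nhdsWithin] with ε hε
      have := hline ε (le_of_lt hε)
      have h' : Continuous fun t : ℝ => ((1 - |t| / L : ℝ) : ℂ) *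
        Complex.exp (t * u * Complex.I) := by fun_prop
      exact (h'.mul this).aestronglyMeasurable
    · have : Ioo (0 : ℝ) 1 ∈ 𝓝[>] (0 : ℝ) := Ioo_mem_nhdsGT one_pos
      filter_upwards [this] with ε hε
      refine Eventually.of_forall fun t ht => ?_
      rw [uIoc_of_le (by linarith)] at ht
      have hg := hC _ ⟨(ε, t), ⟨⟨hε.1.le, hε.2.le⟩, ⟨ht.1.le, ht.2⟩⟩, rfl⟩
      have h1 : |t| ≤ L := abs_le.2 ⟨ht.1.le, ht.2⟩
      have h2 : |1 - |t| / L| ≤ 1 := by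
        rw [abs_le]
        have h3 : |t| / L ≤ 1 := (div_le_one hL).2 h1
        have h4 : 0 ≤ |t| / L := by positivity
        constructor <;> linarith
      have e3 : (t * u * Complex.I : ℂ).re = 0 := by simp
      rw [norm_mul, norm_mul, Complex.norm_real, Complex.norm_exp, e3, exp_zero, mul_one,
        Real.norm_eq_abs]
      calc _ ≤ 1 * C := by gcongr
        _ = C := one_mul _
    · refine Eventually.of_forall fun t ht => ?_
      refine Tendsto.const_mul _ ?_
      have h0 : ContinuousWithinAt G {s | 0 ≤ s.re} (t * Complex.I) := hGc _ (by simp)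
      refine h0.tendsto.comp (tendsto_nhdsWithin_iff.2 ⟨?_, ?_⟩)
      · have : Continuous fun ε : ℝ => (ε + t * Complex.I : ℂ) := by fun_prop
        have h := (this.tendsto 0).mono_left (nhdsWithin_le_nhds (s := Ioi (0 : ℝ)))
        simpa using h
      · filter_upwards [self_mem_nhdsWithin] with ε hε
        simpa using (le_of_lt hε : (0 : ℝ) ≤ ε)
  have hint : Integrable fun v => fejer L (u - v) := (integrable_fejer hL).comp_sub_left u
  have l2 : Tendsto (fun ε : ℝ => ∫ v in Ioi (0 : ℝ), f v * exp (-ε * v) * fejer L (u - v))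
      (𝓝[>] 0) (𝓝 (∫ v in Ioi (0 : ℝ), f v * fejer L (u - v))) := by
    have hfc := continuous_fejer L
    refine tendsto_integral_filter_of_dominated_convergence (fun v => B * fejer L (u - v))
      ?_ ?_ (hint.const_mul B).integrableOn ?_
    · refine Eventually.of_forall fun ε => Measurable.aestronglyMeasurable ?_
      have := hfc.measurable
      fun_prop
    · filter_upwards [self_mem_nhdsWithin] with ε hε
      refine (ae_restrict_iff' measurableSet_Ioi).2 (Eventually.of_forall fun v hv => ?_)
      rw [norm_mul, norm_mul, Real.norm_of_nonneg (fejer_nonneg hL _), Real.norm_eq_abs,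
        Real.norm_of_nonneg (exp_pos _).le]
      have h1 : exp (-ε * v) ≤ 1 := by
        rw [exp_le_one_iff]
        have := mul_pos (show 0 < ε from hε) (show 0 < v from hv)
        linarith
      have h2 := fejer_nonneg hL (u - v)
      gcongr
      calc _ ≤ B * 1 := by gcongr; exact hfB v
        _ = B := mul_one _
    · refine Eventually.of_forall fun v => ?_
      refine Tendsto.mul_const _ ?_
      have : Continuous fun ε : ℝ => f v * exp (-ε * v) := by fun_prop
      have h := (this.tendsto 0).mono_left (nhdsWithin_le_nhds (s := Ioi (0 : ℝ)))
      simpa using h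
  refine tendsto_nhds_unique l1 ?_
  refine Tendsto.congr' ?_ ((Complex.continuous_ofReal.tendsto _).comp l2)
  filter_upwards [self_mem_nhdsWithin] with ε hε
  exact (integral_triangle_laplace hfm hfB hL hG u hε).symm

theorem tendsto_integral_mul_fejer (hfm : Measurable f) (hfB : ∀ v, |f v| ≤ B) (hL : 0 < L)
    (hG : ∀ s : ℂ, 0 < s.re → ∫ v in Ioi (0 : ℝ), (f v : ℂ) * Complex.exp (-s * v) = G s)
    (hGc : ContinuousOn G {s | 0 ≤ s.re}) :
    Tendsto (fun u => ∫ v in Ioi (0 : ℝ), f v * fejer L (u - v)) atTop (𝓝 0) := by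
  have h1 := Real.tendsto_integral_exp_smul_cocompact
    ((Ioc (-L) L).indicator fun t : ℝ => ((1 - |t| / L : ℝ) : ℂ) * G (t * Complex.I))
  have h2 : Tendsto (fun u : ℝ => -u / (2 * π)) atTop (cocompact ℝ) := by
    have : Tendsto (fun u : ℝ => -u / (2 * π)) atTop atBot :=
      tendsto_neg_atTop_atBot.atBot_div_const (by positivity)
    exact this.mono_right atBot_le_cocompact
  have h3 := (Complex.continuous_re.tendsto _).comp (h1.comp h2)
  refine h3.congr fun u => ?_
  simp only [Function.comp]
  have e := integral_triangle_laplace_zero hfm hfB hL hG hGc u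
  rw [show (∫ v in Ioi (0 : ℝ), f v * fejer L (u - v)) =
    (((∫ v in Ioi (0 : ℝ), f v * fejer L (u - v)) : ℝ) : ℂ).re from rfl, ← e]
  congr 1
  rw [intervalIntegral.integral_of_le (by linarith), ← integral_indicator measurableSet_Ioc]
  refine integral_congr_ae (Eventually.of_forall fun t => ?_)
  by_cases ht : t ∈ Ioc (-L) L
  · simp only [indicator_of_mem ht, Circle.smul_def, Real.fourierChar_apply, smul_eq_mul]
    have : (((2 * π * -(t * (-u / (2 * π))) : ℝ) : ℂ)) * Complex.I = t * u * Complex.I := by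
      have : (2 * π * -(t * (-u / (2 * π))) : ℝ) = t * u := by field_simp
      rw [this]; push_cast; ring
    rw [this]; ring
  · simp [indicator_of_notMem ht]

end Tauberian

section PrimeNumberTheorem
open MeasureTheory Set Topology

lemma psi_exp_mul_exp_neg_le (v : ℝ) : Chebyshev.psi (exp v) * exp (-v) ≤ log 4 + 4 := by
  rw [exp_neg, ← div_eq_mul_inv, div_le_iff₀ (exp_pos v)]
  exact Chebyshev.psi_le_const_mul_self (exp_pos v).le

lemma psi_exp_mul_exp_neg_nonneg (v : ℝ) : 0 ≤ Chebyshev.psi (exp v) * exp (-v) :=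
  mul_nonneg (Chebyshev.psi_nonneg _) (exp_pos _).le

lemma measurable_psi_exp : Measurable fun v : ℝ => Chebyshev.psi (exp v) * exp (-v) := by
  have := Chebyshev.psi_mono.measurable
  fun_prop

lemma exists_laplace_psi : ∃ G : ℂ → ℂ, ContinuousOn G {s | 0 ≤ s.re} ∧
    ∀ s : ℂ, 0 < s.re → ∫ v in Ioi (0 : ℝ),
      ((Chebyshev.psi (exp v) * exp (-v) - 1 : ℝ) : ℂ) * Complex.exp (-s * v) = G s := by
  let A := ArithmeticFunction.vonMangoldt.LFunctionResidueClassAux (q := 1) 1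
  refine ⟨fun s => (A (1 + s) - 1) / (1 + s), ?_, ?_⟩
  · have hA : ContinuousOn A {s | 1 ≤ s.re} :=
      ArithmeticFunction.vonMangoldt.continuousOn_LFunctionResidueClassAux _
    refine ContinuousOn.div ((hA.comp (by fun_prop) ?_).sub continuousOn_const) (by fun_prop) ?_
    · intro s hs
      simpa using hs
    · intro s hs h
      have := congrArg Complex.re h
      simp only [Complex.add_re, Complex.one_re, Complex.zero_re] at this
      have h0 : 0 ≤ s.re := hs
      linarith
  · intro s hs
    have hs1 : 1 < (1 + s).re := by simpa using hs
    have hne : (1 + s) ≠ 0 := by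
      intro h; rw [h] at hs1; norm_num at hs1
    have hs0 : s ≠ 0 := by rintro rfl; simp at hs
    have hA : A (1 + s) = LSeries (fun n => (ArithmeticFunction.vonMangoldt n : ℂ)) (1 + s)
        - 1 / s := by
      have := ArithmeticFunction.vonMangoldt.eqOn_LFunctionResidueClassAux (q := 1) (a := 1)
        isUnit_one hs1
      change ArithmeticFunction.vonMangoldt.LFunctionResidueClassAux (q := 1) 1 (1 + s) = _
      rw [this]
      have hr : (fun n : ℕ => (ArithmeticFunction.vonMangoldt.residueClass (1 : ZMod 1) n : ℂ))
          = fun n => (ArithmeticFunction.vonMangoldt n : ℂ) := by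
        funext n
        rw [ArithmeticFunction.vonMangoldt.residueClass, indicator_of_mem]
        exact Subsingleton.elim _ _
      rw [hr]
      simp
    have hpsi : ∀ t : ℝ, (∑ k ∈ Finset.Icc 1 ⌊t⌋₊, (ArithmeticFunction.vonMangoldt k : ℂ))
        = (Chebyshev.psi t : ℂ) := by
      intro t
      rw [Chebyshev.psi]
      push_cast
      rfl
    have hL := LSeries_eq_mul_integral (fun n => (ArithmeticFunction.vonMangoldt n : ℂ)) (r := 1)
      zero_le_one hs1 (ArithmeticFunction.LSeriesSummable_vonMangoldt hs1) (by
        refine Asymptotics.IsBigO.of_bound (log 4 + 4) (Eventually.of_forall fun n => ?_)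
        have := hpsi n
        rw [Nat.floor_natCast] at this
        rw [this, Complex.norm_real, Real.norm_of_nonneg (Chebyshev.psi_nonneg _), rpow_one,
          Real.norm_of_nonneg (Nat.cast_nonneg n)]
        exact Chebyshev.psi_le_const_mul_self (Nat.cast_nonneg n))
    simp only [hpsi] at hL
    have himg : exp '' Ioi (0 : ℝ) = Ioi 1 := by
      ext y
      constructor
      · rintro ⟨x, hx, rfl⟩
        exact one_lt_exp_iff.2 hx
      · intro hy
        have hy' : (1 : ℝ) < y := hy
        exact ⟨log y, log_pos hy', exp_log (by linarith)⟩
    have hcv : ∫ t in Ioi (1 : ℝ), (Chebyshev.psi t : ℂ) * (t : ℂ) ^ (-(1 + s + 1))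
        = ∫ v in Ioi (0 : ℝ), ((Chebyshev.psi (exp v) * exp (-v) : ℝ) : ℂ)
          * Complex.exp (-s * v) := by
      rw [← himg, integral_image_eq_integral_abs_deriv_smul measurableSet_Ioi
        (fun x _ => (hasDerivAt_exp x).hasDerivWithinAt) exp_injective.injOn]
      refine setIntegral_congr_fun measurableSet_Ioi fun v _ => ?_
      have h1 : ((exp v : ℝ) : ℂ) ^ (-(1 + s + 1)) = Complex.exp (v * (-(1 + s + 1))) := by
        rw [Complex.cpow_def_of_ne_zero (by exact_mod_cast (exp_pos v).ne'),
          ← Complex.ofReal_log (exp_pos v).le, log_exp]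
      simp only [h1, abs_of_pos (exp_pos v), Complex.real_smul]
      have h2 : Complex.exp v * Complex.exp (v * (-(1 + s + 1)))
          = Complex.exp (-v) * Complex.exp (-s * v) := by
        rw [← Complex.exp_add, ← Complex.exp_add]
        congr 1; ring
      push_cast
      linear_combination (Chebyshev.psi (exp v) : ℂ) * h2
    have hone : ∫ v in Ioi (0 : ℝ), Complex.exp (-s * v) = 1 / s := by
      rw [integral_exp_mul_complex_Ioi (by simpa using hs)]
      simp only [Complex.ofReal_zero, mul_zero, Complex.exp_zero]
      rw [neg_div_neg_eq]
    have hi2 : IntegrableOn (fun v : ℝ => Complex.exp (-s * v)) (Ioi 0) :=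
      integrableOn_exp_mul_complex_Ioi (by simpa using hs) 0
    have hi1 : IntegrableOn (fun v : ℝ => ((Chebyshev.psi (exp v) * exp (-v) : ℝ) : ℂ)
          * Complex.exp (-s * v)) (Ioi 0) := by
      refine hi2.bdd_mul (c := log 4 + 4) ?_ (Eventually.of_forall fun v => ?_)
      · exact (Complex.measurable_ofReal.comp measurable_psi_exp).aestronglyMeasurable
      · rw [Complex.norm_real, Real.norm_of_nonneg (psi_exp_mul_exp_neg_nonneg v)]
        exact psi_exp_mul_exp_neg_le v
    have hsplit : ∀ v : ℝ, ((Chebyshev.psi (exp v) * exp (-v) - 1 : ℝ) : ℂ) * Complex.exp (-s * v)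
        = ((Chebyshev.psi (exp v) * exp (-v) : ℝ) : ℂ) * Complex.exp (-s * v)
          - Complex.exp (-s * v) := by
      intro v; push_cast; ring
    simp_rw [hsplit]
    rw [integral_sub hi1 hi2, ← hcv, hone, hA, hL]
    field_simp
    ring

lemma tendsto_integral_psi_mul_fejer {L : ℝ} (hL : 0 < L) :
    Tendsto (fun u => ∫ v in Ioi (0 : ℝ), Chebyshev.psi (exp v) * exp (-v) * fejer L (u - v))
      atTop (𝓝 (∫ x, fejer L x)) := by
  obtain ⟨G, hGc, hG⟩ := exists_laplace_psi
  have h1 := tendsto_integral_mul_fejer (B := log 4 + 4 + 1)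
    (measurable_psi_exp.sub_const 1) (fun v => by
      have h1 := psi_exp_mul_exp_neg_nonneg v
      have h2 := psi_exp_mul_exp_neg_le v
      rw [abs_le]; constructor <;> linarith) hL hG hGc
  have hi : ∀ u, Integrable fun v => fejer L (u - v) := fun u => (integrable_fejer hL).comp_sub_left u
  have h2 : Tendsto (fun u => ∫ v in Ioi (0 : ℝ), fejer L (u - v)) atTop
      (𝓝 (∫ x, fejer L x)) := by
    have h3 := (aecover_Iio (μ := volume) (tendsto_id (α := ℝ) (x := atTop))).integral_tendsto_of_countably_generated
      (integrable_fejer hL)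
    refine h3.congr fun u => ?_
    rw [← integral_indicator measurableSet_Iio, ← integral_indicator measurableSet_Ioi,
      ← integral_sub_left_eq_self _ volume u]
    refine integral_congr_ae (Eventually.of_forall fun v => ?_)
    simp [indicator, sub_lt_self_iff]
  have h3 := h1.add h2
  rw [zero_add] at h3
  refine h3.congr fun u => ?_
  rw [← integral_add _ (hi u).integrableOn]
  · refine integral_congr_ae (Eventually.of_forall fun v => ?_)
    simp only; ring
  · refine (hi u).integrableOn.bdd_mul (c := log 4 + 4 + 1)
      (measurable_psi_exp.sub_const 1).aestronglyMeasurable (Eventually.of_forall fun v => ?_)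
    have h1 := psi_exp_mul_exp_neg_nonneg v
    have h2 := psi_exp_mul_exp_neg_le v
    rw [Real.norm_eq_abs, abs_le]; constructor <;> linarith

lemma fejer_eq (L x : ℝ) : fejer L x = L * fejer 1 (L * x) := by
  simp [fejer]

lemma integral_fejer {L : ℝ} (hL : 0 < L) : ∫ x, fejer L x = ∫ x, fejer 1 x := by
  simp_rw [fejer_eq L]
  rw [integral_const_mul, Measure.integral_comp_mul_left, abs_of_pos (inv_pos.2 hL), smul_eq_mul,
    mul_inv_cancel_left₀ hL.ne']

lemma integral_fejer_pos : 0 < ∫ x, fejer 1 x := by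
  rw [integral_pos_iff_support_of_nonneg (fun x => fejer_nonneg one_pos x)
    (integrable_fejer one_pos)]
  exact (continuous_fejer 1).isOpen_support.measure_pos _ ⟨0, by simp [fejer]⟩

lemma exists_fejer_window {η c : ℝ} (hη : 0 < η) (hc : c < ∫ x, fejer 1 x) :
    ∃ L : ℝ, 0 < L ∧ c < ∫ x in Icc (-η) η, fejer L x := by
  have h1 := intervalIntegral_tendsto_integral (integrable_fejer one_pos)
    (tendsto_neg_atTop_atBot (G := ℝ)) tendsto_id
  have h2 : Tendsto (fun L : ℝ => L * η) atTop atTop := tendsto_id.atTop_mul_const hη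
  obtain ⟨L, hL0, hL⟩ := ((eventually_gt_atTop 0).and ((h1.comp h2).eventually_const_lt hc)).exists
  refine ⟨L, hL0, hL.trans_le (le_of_eq ?_)⟩
  rw [integral_Icc_eq_integral_Ioc, ← intervalIntegral.integral_of_le (by linarith)]
  simp_rw [fejer_eq L]
  rw [intervalIntegral.integral_const_mul, intervalIntegral.mul_integral_comp_mul_left]
  simp

lemma setIntegral_fejer_sub (L w a b : ℝ) :
    ∫ v in Icc a b, fejer L (w - v) = ∫ x in Icc (w - b) (w - a), fejer L x := by
  rw [← integral_indicator measurableSet_Icc, ← integral_indicator measurableSet_Icc,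
      ← integral_sub_left_eq_self _ volume w]
  refine integral_congr_ae (Eventually.of_forall fun v => ?_)
  have : w - v ∈ Icc a b ↔ v ∈ Icc (w - b) (w - a) := by
    simp only [mem_Icc]; constructor <;> rintro ⟨_, _⟩ <;> constructor <;> linarith
  by_cases h : v ∈ Icc (w - b) (w - a) <;> simp only [indicator, this, h, sub_sub_cancel, if_true, if_false]

lemma psi_exp_mul_exp_neg_le_mul {u v δ : ℝ} (h : u ≤ v) (h' : v ≤ u + 2 * δ) :
    exp (-(2 * δ)) * (Chebyshev.psi (exp u) * exp (-u)) ≤ Chebyshev.psi (exp v) * exp (-v) := by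
  have h1 : Chebyshev.psi (exp u) ≤ Chebyshev.psi (exp v) := Chebyshev.psi_mono (exp_le_exp.2 h)
  have h2 : exp (-(2 * δ)) * exp (-u) ≤ exp (-v) := by
    rw [← exp_add, exp_le_exp]; linarith
  calc _ = Chebyshev.psi (exp u) * (exp (-(2 * δ)) * exp (-u)) := by ring
    _ ≤ _ := mul_le_mul h1 h2 (by positivity) (Chebyshev.psi_nonneg _)

lemma eventually_psi_bounds {δ : ℝ} (hδ : 0 < δ) :
    ∀ᶠ u in atTop, (1 - δ) * (exp (-(2 * δ)) * (Chebyshev.psi (exp u) * exp (-u))) ≤ 1 + δ ∧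
      1 - δ ≤ exp (2 * δ) * (Chebyshev.psi (exp u) * exp (-u)) + (log 4 + 4) * δ := by
  set κ := ∫ x, fejer 1 x with hκ
  have hκ0 : 0 < κ := integral_fejer_pos
  obtain ⟨L, hL, hw⟩ := exists_fejer_window (c := (1 - δ) * κ) hδ (by nlinarith)
  have hlim := tendsto_integral_psi_mul_fejer hL
  rw [integral_fejer hL, ← hκ] at hlim
  have hup := (hlim.comp (tendsto_atTop_add_const_right atTop δ tendsto_id)).eventually_lt_const
    (show κ < (1 + δ) * κ by nlinarith)
  have hlo := (hlim.comp (tendsto_atTop_add_const_right atTop (-δ) tendsto_id)).eventually_const_lt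
    (show (1 - δ) * κ < κ by nlinarith)
  have hi : ∀ u, Integrable fun v => fejer L (u - v) :=
    fun u => (integrable_fejer hL).comp_sub_left u
  have hSi : ∀ w, Integrable fun v => Chebyshev.psi (exp v) * exp (-v) * fejer L (w - v) := by
    intro w
    refine (hi w).bdd_mul (c := log 4 + 4)
      measurable_psi_exp.aestronglyMeasurable (Eventually.of_forall fun v => ?_)
    rw [Real.norm_of_nonneg (psi_exp_mul_exp_neg_nonneg v)]
    exact psi_exp_mul_exp_neg_le v
  have hSn : ∀ w v, 0 ≤ Chebyshev.psi (exp v) * exp (-v) * fejer L (w - v) := fun w v =>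
    mul_nonneg (psi_exp_mul_exp_neg_nonneg v) (fejer_nonneg hL _)
  filter_upwards [hup, hlo, eventually_gt_atTop (2 * δ)] with u h1 h2 h3
  simp only [Function.comp, id] at h1 h2
  constructor
  · have e1 : ∫ v in Icc u (u + 2 * δ), exp (-(2 * δ)) * (Chebyshev.psi (exp u) * exp (-u)) *
        fejer L (u + δ - v) ≤ ∫ v in Ioi (0 : ℝ), Chebyshev.psi (exp v) * exp (-v) *
        fejer L (u + δ - v) := by
      calc _ ≤ ∫ v in Icc u (u + 2 * δ), Chebyshev.psi (exp v) * exp (-v) *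
          fejer L (u + δ - v) := by
            refine setIntegral_mono_on ((hi _).const_mul _).integrableOn (hSi _).integrableOn
              measurableSet_Icc fun v hv => ?_
            exact mul_le_mul_of_nonneg_right (psi_exp_mul_exp_neg_le_mul hv.1 hv.2)
              (fejer_nonneg hL _)
        _ ≤ _ := by
            refine setIntegral_mono_set (hSi _).integrableOn
              (Eventually.of_forall fun v => hSn _ v) ?_
            exact (LE.le.eventuallyLE fun v hv => by
              have := hv.1; simp only [mem_Ioi]; linarith)
    rw [integral_const_mul, setIntegral_fejer_sub, show u + δ - (u + 2 * δ) = -δ by ring,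
      show u + δ - u = δ by ring] at e1
    have hp : 0 ≤ exp (-(2 * δ)) * (Chebyshev.psi (exp u) * exp (-u)) :=
      mul_nonneg (exp_pos _).le (psi_exp_mul_exp_neg_nonneg u)
    have e2 := mul_le_mul_of_nonneg_left hw.le hp
    refine le_of_mul_le_mul_right ?_ hκ0
    linarith
  · have hrest : ∫ v in (Icc (u - 2 * δ) u)ᶜ, fejer L (u + -δ - v) ≤ δ * κ := by
      have := integral_add_compl (measurableSet_Icc (a := u - 2 * δ) (b := u)) (hi (u + -δ))
      rw [setIntegral_fejer_sub, show u + -δ - u = -δ by ring,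
        show u + -δ - (u - 2 * δ) = δ by ring,
        integral_sub_left_eq_self (fejer L) volume (u + -δ), integral_fejer hL] at this
      linarith
    have e1 : ∫ v in Ioi (0 : ℝ), Chebyshev.psi (exp v) * exp (-v) * fejer L (u + -δ - v) ≤
        (∫ v in Icc (u - 2 * δ) u, exp (2 * δ) * (Chebyshev.psi (exp u) * exp (-u)) *
          fejer L (u + -δ - v)) +
        ∫ v in (Icc (u - 2 * δ) u)ᶜ, (log 4 + 4) * fejer L (u + -δ - v) := by
      calc _ ≤ ∫ v, Chebyshev.psi (exp v) * exp (-v) * fejer L (u + -δ - v) :=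
            setIntegral_le_integral (hSi _) (Eventually.of_forall fun v => hSn _ v)
        _ = _ := (integral_add_compl (measurableSet_Icc (a := u - 2 * δ) (b := u))
            (hSi (u + -δ))).symm
        _ ≤ _ := by
          refine add_le_add ?_ ?_
          · refine setIntegral_mono_on (hSi _).integrableOn ((hi _).const_mul _).integrableOn
              measurableSet_Icc fun v hv => ?_
            refine mul_le_mul_of_nonneg_right ?_ (fejer_nonneg hL _)
            have h := psi_exp_mul_exp_neg_le_mul (δ := δ) hv.2 (by linarith [hv.1])
            have := mul_le_mul_of_nonneg_left h (exp_pos (2 * δ)).le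
            rwa [← mul_assoc, ← exp_add, add_neg_cancel, exp_zero, one_mul] at this
          · refine setIntegral_mono_on (hSi _).integrableOn ((hi _).const_mul _).integrableOn
              measurableSet_Icc.compl fun v hv => ?_
            exact mul_le_mul_of_nonneg_right (psi_exp_mul_exp_neg_le v) (fejer_nonneg hL _)
    rw [integral_const_mul, integral_const_mul] at e1
    have hwin : ∫ v in Icc (u - 2 * δ) u, fejer L (u + -δ - v) ≤ κ := by
      rw [hκ, ← integral_fejer hL, ← integral_sub_left_eq_self (fejer L) volume (u + -δ)]
      exact setIntegral_le_integral (hi _) (Eventually.of_forall fun v => fejer_nonneg hL _)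
    have hp : 0 ≤ exp (2 * δ) * (Chebyshev.psi (exp u) * exp (-u)) :=
      mul_nonneg (exp_pos _).le (psi_exp_mul_exp_neg_nonneg u)
    have e2 := mul_le_mul_of_nonneg_left hwin hp
    have e3 := mul_le_mul_of_nonneg_left hrest (show 0 ≤ log 4 + 4 by positivity)
    refine le_of_mul_le_mul_right ?_ hκ0
    linarith

/-- The prime number theorem. -/
theorem tendsto_psi_div : Tendsto (fun x : ℝ => Chebyshev.psi x / x) atTop (𝓝 1) := by
  have key : Tendsto (fun u : ℝ => Chebyshev.psi (exp u) * exp (-u)) atTop (𝓝 1) := by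
    rw [tendsto_order]
    constructor
    · intro a ha
      have hc : Tendsto (fun δ : ℝ => exp (-(2 * δ)) * (1 - δ - (log 4 + 4) * δ)) (𝓝[>] 0)
          (𝓝 1) := by
        have : Continuous fun δ : ℝ => exp (-(2 * δ)) * (1 - δ - (log 4 + 4) * δ) := by fun_prop
        simpa using (this.tendsto 0).mono_left (nhdsWithin_le_nhds (s := Ioi (0 : ℝ)))
      obtain ⟨δ, h1, h2⟩ := ((hc.eventually_const_lt ha).and self_mem_nhdsWithin).exists
      filter_upwards [eventually_psi_bounds h2] with u hu
      refine h1.trans_le ?_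
      rw [exp_neg, inv_mul_le_iff₀ (exp_pos _)]
      linarith [hu.2]
    · intro a ha
      have hc : Tendsto (fun δ : ℝ => exp (2 * δ) * ((1 + δ) / (1 - δ))) (𝓝[>] 0)
          (𝓝 1) := by
        have : ContinuousAt (fun δ : ℝ => exp (2 * δ) * ((1 + δ) / (1 - δ))) 0 := by
          refine ContinuousAt.mul (by fun_prop) (ContinuousAt.div (by fun_prop) (by fun_prop) ?_)
          norm_num
        simpa using this.tendsto.mono_left (nhdsWithin_le_nhds (s := Ioi (0 : ℝ)))
      obtain ⟨δ, h1, h2⟩ := ((hc.eventually_lt_const ha).and (Ioo_mem_nhdsGT one_pos)).exists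
      filter_upwards [eventually_psi_bounds h2.1] with u hu
      refine lt_of_le_of_lt ?_ h1
      have h3 : 0 < 1 - δ := by linarith [h2.2]
      have h4 := hu.1
      rw [← le_div_iff₀' h3, exp_neg, inv_mul_le_iff₀ (exp_pos _)] at h4
      exact h4
  refine (key.comp tendsto_log_atTop).congr' ?_
  filter_upwards [eventually_gt_atTop 0] with x hx
  simp only [Function.comp]
  rw [exp_neg, exp_log hx, div_eq_mul_inv]

end PrimeNumberTheorem

section GreedyColoring
open Topology Finset

/-- The weight `-log (1 - 1 / n)`. -/
noncomputable def eulerWeight (n : ℕ) : ℝ := -log (1 - (n : ℝ)⁻¹)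

lemma eulerWeight_anti {m n : ℕ} (hm : 2 ≤ m) (hmn : m ≤ n) : eulerWeight n ≤ eulerWeight m := by
  have h2 : (2 : ℝ) ≤ m := by exact_mod_cast hm
  have hi : (m : ℝ)⁻¹ ≤ 2⁻¹ := inv_anti₀ two_pos h2
  have hi' : (n : ℝ)⁻¹ ≤ (m : ℝ)⁻¹ := inv_anti₀ (by linarith) (by exact_mod_cast hmn)
  exact neg_le_neg (log_le_log (by linarith) (by linarith))

lemma inv_le_eulerWeight {n : ℕ} (hn : 2 ≤ n) : (n : ℝ)⁻¹ ≤ eulerWeight n := by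
  have h2 : (2 : ℝ) ≤ n := by exact_mod_cast hn
  have hi : (n : ℝ)⁻¹ ≤ 2⁻¹ := inv_anti₀ two_pos h2
  have := log_le_sub_one_of_pos (show 0 < 1 - (n : ℝ)⁻¹ by linarith)
  unfold eulerWeight; linarith

lemma eulerWeight_le {n : ℕ} (hn : 2 ≤ n) : eulerWeight n ≤ 2 * (n : ℝ)⁻¹ := by
  have h2 : (2 : ℝ) ≤ n := by exact_mod_cast hn
  have hi : (n : ℝ)⁻¹ ≤ 2⁻¹ := inv_anti₀ two_pos h2
  have h0 : 0 < (n : ℝ)⁻¹ := by positivity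
  have h1 : 0 < 1 - (n : ℝ)⁻¹ := by linarith
  have := one_sub_inv_le_log_of_pos h1
  have h3 : (1 - (n : ℝ)⁻¹)⁻¹ ≤ 1 + 2 * (n : ℝ)⁻¹ := by
    rw [inv_le_iff_one_le_mul₀ h1]; nlinarith
  unfold eulerWeight; linarith

lemma eulerWeight_pos {n : ℕ} (hn : 2 ≤ n) : 0 < eulerWeight n :=
  lt_of_lt_of_le (by positivity) (inv_le_eulerWeight hn)

variable {h : ℕ} [NeZero h]

/-- The index of a smallest entry of a vector. -/
noncomputable def argMin (v : Fin h → ℝ) : Fin h := (Finite.exists_min v).choose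

lemma argMin_le (v : Fin h → ℝ) (j : Fin h) : v (argMin v) ≤ v j :=
  (Finite.exists_min v).choose_spec j

/-- The loads of the `h` classes when the primes below `n` have been distributed greedily. -/
noncomputable def greedyLoad (h : ℕ) [NeZero h] : ℕ → Fin h → ℝ
  | 0 => 0
  | n + 1 => fun i => greedyLoad h n i +
      if n.Prime ∧ argMin (greedyLoad h n) = i then eulerWeight n else 0

/-- The class of `n` under the greedy distribution of the primes. -/
noncomputable def greedyColor (h : ℕ) [NeZero h] (n : ℕ) : Fin h := argMin (greedyLoad h n)

lemma greedyLoad_eq_sum (n : ℕ) (i : Fin h) : greedyLoad h n i =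
    ∑ p ∈ range n, if p.Prime ∧ greedyColor h p = i then eulerWeight p else 0 := by
  induction n with
  | zero => simp [greedyLoad]
  | succ n ih => rw [sum_range_succ, ← ih]; rfl

lemma greedyLoad_mono (i : Fin h) : Monotone fun n => greedyLoad h n i := by
  refine monotone_nat_of_le_succ fun n => ?_
  simp only [greedyLoad]
  split_ifs with hn
  · linarith [eulerWeight_pos hn.1.two_le]
  · simp

lemma greedyLoad_dichotomy {y n : ℕ} (hy : 2 ≤ y) (hn : y ≤ n) (i : Fin h) :
    (∀ j, greedyLoad h n i ≤ greedyLoad h n j + eulerWeight y) ∨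
      greedyLoad h n i = greedyLoad h y i := by
  induction n, hn using Nat.le_induction with
  | base => exact Or.inr rfl
  | succ n hn ih =>
    by_cases hi : n.Prime ∧ argMin (greedyLoad h n) = i
    · left
      intro j
      have h1 := greedyLoad_mono j (Nat.le_succ n)
      have h2 := argMin_le (greedyLoad h n) j
      have h3 := eulerWeight_anti hy hn
      rw [hi.2] at h2
      have h4 : greedyLoad h (n + 1) i = greedyLoad h n i + eulerWeight n := by
        simp [greedyLoad, hi]
      simp only [Nat.succ_eq_add_one] at h1
      linarith
    · have h4 : greedyLoad h (n + 1) i = greedyLoad h n i := by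
        simp only [greedyLoad, if_neg hi, add_zero]
      rw [h4]
      refine ih.imp_left fun hj j => (hj j).trans ?_
      have h1 := greedyLoad_mono j (Nat.le_succ n)
      simp only [Nat.succ_eq_add_one] at h1
      linarith

lemma greedyLoad_two (i : Fin h) : greedyLoad h 2 i = 0 := by
  rw [greedyLoad_eq_sum]
  refine sum_eq_zero fun p hp => if_neg fun hp' => ?_
  have := hp'.1.two_le
  simp at hp; omega

lemma greedyLoad_le_add {n : ℕ} (hn : 2 ≤ n) (i j : Fin h) :
    greedyLoad h n i ≤ greedyLoad h n j + eulerWeight 2 := by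
  rcases greedyLoad_dichotomy le_rfl hn i with h1 | h1
  · exact h1 j
  · have h2 := greedyLoad_mono j hn
    have h3 := eulerWeight_pos (le_refl 2)
    simp only [greedyLoad_two] at h1 h2
    linarith

lemma sum_greedyLoad (n : ℕ) : ∑ i : Fin h, greedyLoad h n i =
    ∑ p ∈ range n with p.Prime, eulerWeight p := by
  simp_rw [greedyLoad_eq_sum]
  rw [sum_comm, sum_filter]
  refine sum_congr rfl fun p _ => ?_
  by_cases hp : p.Prime <;> simp [hp]

lemma greedyLoad_le_add_of_lt {y n : ℕ} (hy : 2 ≤ y) (hn : y ≤ n)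
    (hC : h * (2 * eulerWeight 2) < (∑ p ∈ range n with p.Prime, eulerWeight p) -
      ∑ p ∈ range y with p.Prime, eulerWeight p) (i j : Fin h) :
    greedyLoad h n i ≤ greedyLoad h n j + eulerWeight y := by
  by_contra hcon
  -- a class that received nothing keeps the total bounded
  have hi : greedyLoad h n i = greedyLoad h y i :=
    (greedyLoad_dichotomy hy hn i).resolve_left fun h1 => hcon (h1 j)
  refine hC.not_ge ?_
  rw [← sum_greedyLoad (h := h), ← sum_greedyLoad (h := h), ← sum_sub_distrib]
  refine (sum_le_card_nsmul _ _ (2 * eulerWeight 2) fun k _ => ?_).trans (by simp)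
  have h1 := greedyLoad_le_add (hy.trans hn) k i
  have h2 := greedyLoad_le_add hy i k
  linarith

end GreedyColoring

section PrimeSums
open Topology Finset

lemma tendsto_sqrt_mul_log_div : Tendsto (fun x : ℝ => √x * log x / x) atTop (𝓝 0) := by
  have h1 : Tendsto (fun x : ℝ => log x / x ^ (1 / 2 : ℝ)) atTop (𝓝 0) :=
    (isLittleO_log_rpow_atTop (by norm_num)).tendsto_div_nhds_zero
  refine h1.congr' ?_
  filter_upwards [eventually_gt_atTop 0] with x hx
  rw [← sqrt_eq_rpow]
  have h2 : √x * √x = x := mul_self_sqrt hx.le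
  have h3 : 0 < √x := sqrt_pos.2 hx
  field_simp
  rw [sq, h2]

lemma tendsto_theta_div : Tendsto (fun x : ℝ => Chebyshev.theta x / x) atTop (𝓝 1) := by
  have h1 : Tendsto (fun x : ℝ => Chebyshev.psi x / x - 2 * (√x * log x / x)) atTop (𝓝 1) := by
    simpa using tendsto_psi_div.sub (tendsto_sqrt_mul_log_div.const_mul 2)
  refine tendsto_of_tendsto_of_tendsto_of_le_of_le' h1 tendsto_psi_div ?_ ?_
  · filter_upwards [eventually_ge_atTop 1] with x hx
    have := Chebyshev.psi_sub_theta_le hx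
    have hx0 : 0 < x := by linarith
    rw [le_div_iff₀ hx0, sub_mul, mul_assoc, div_mul_cancel₀ _ hx0.ne',
      div_mul_cancel₀ _ hx0.ne']
    linarith
  · filter_upwards [eventually_gt_atTop 0] with x hx
    exact div_le_div_of_nonneg_right (Chebyshev.theta_le_psi x) hx.le

lemma theta_natCast (n : ℕ) :
    Chebyshev.theta n = ∑ p ∈ range (n + 1) with p.Prime, log p := by
  rw [Chebyshev.theta_eq_sum_Icc, Nat.floor_natCast, range_eq_Ico, ← Ico_add_one_right_eq_Icc]

lemma sum_eulerWeight_dyadic_le : ∃ j₀ : ℕ, ∀ j ≥ j₀, (1 / 4 : ℝ) * ((j : ℝ) + 1)⁻¹ ≤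
    (∑ p ∈ range (2 ^ (j + 1) + 1) with p.Prime, eulerWeight p) -
      ∑ p ∈ range (2 ^ j + 1) with p.Prime, eulerWeight p := by
  have hpow : Tendsto (fun j : ℕ => (2 : ℝ) ^ j) atTop atTop :=
    tendsto_pow_atTop_atTop_of_one_lt one_lt_two
  have hpow' : Tendsto (fun j : ℕ => (2 : ℝ) ^ (j + 1)) atTop atTop :=
    hpow.comp (tendsto_add_atTop_nat 1)
  have h1 := (tendsto_theta_div.comp hpow').eventually_const_lt (show (7 / 8 : ℝ) < 1 by norm_num)
  have h2 := (tendsto_theta_div.comp hpow).eventually_lt_const (show (1 : ℝ) < 5 / 4 by norm_num)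
  obtain ⟨j₀, hj₀⟩ := eventually_atTop.1 (h1.and h2)
  refine ⟨j₀, fun j hj => ?_⟩
  obtain ⟨h3, h4⟩ := hj₀ j hj
  simp only [Function.comp] at h3 h4
  have hp : (0 : ℝ) < 2 ^ j := by positivity
  rw [lt_div_iff₀ (by positivity)] at h3
  rw [div_lt_iff₀ hp] at h4
  have e1 := theta_natCast (2 ^ (j + 1))
  have e2 := theta_natCast (2 ^ j)
  push_cast at e1 e2
  have hsub : (range (2 ^ j + 1)).filter Nat.Prime ⊆ (range (2 ^ (j + 1) + 1)).filter Nat.Prime := by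
    refine filter_subset_filter _ (range_mono ?_)
    have : 2 ^ j ≤ 2 ^ (j + 1) := Nat.pow_le_pow_right two_pos (Nat.le_succ j)
    omega
  rw [e1] at h3
  rw [e2] at h4
  rw [← sum_sdiff hsub, add_sub_cancel_right]
  rw [← sum_sdiff hsub] at h3
  set S := (range (2 ^ (j + 1) + 1)).filter Nat.Prime \ (range (2 ^ j + 1)).filter Nat.Prime
  have h5 : ∑ p ∈ S, log p ≤ ∑ p ∈ S, eulerWeight p * (2 ^ (j + 1) * (j + 1)) := by
    refine sum_le_sum fun p hp => ?_
    have hp' := (mem_sdiff.1 hp).1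
    rw [mem_filter, mem_range, Nat.lt_succ_iff] at hp'
    have hp2 : (2 : ℝ) ≤ p := by exact_mod_cast hp'.2.two_le
    have hpl : (p : ℝ) ≤ 2 ^ (j + 1) := by exact_mod_cast hp'.1
    have h6 := inv_le_eulerWeight hp'.2.two_le
    have h7 : log p ≤ j + 1 := by
      calc log p ≤ log (2 ^ (j + 1)) := log_le_log (by linarith) hpl
        _ = (j + 1) * log 2 := by rw [log_pow]; push_cast; ring
        _ ≤ (j + 1) * 1 := by
          gcongr
          have := log_two_lt_d9
          linarith
        _ = _ := mul_one _
    have h8 : 1 ≤ eulerWeight p * 2 ^ (j + 1) := by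
      calc (1 : ℝ) = (p : ℝ)⁻¹ * p := by rw [inv_mul_cancel₀]; linarith
        _ ≤ _ := by gcongr; exact (eulerWeight_pos hp'.2.two_le).le
    have : (0 : ℝ) ≤ j + 1 := by positivity
    nlinarith
  rw [← sum_mul] at h5
  have h9 : (2 : ℝ) ^ (j + 1) = 2 * 2 ^ j := by ring
  rw [h9] at h3 h5
  have h10 : (1 : ℝ) / 4 ≤ (∑ p ∈ S, eulerWeight p) * (j + 1) := by
    have : (1 : ℝ) / 4 * (2 * 2 ^ j) ≤ (∑ p ∈ S, eulerWeight p) * (j + 1) * (2 * 2 ^ j) := by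
      linarith
    exact le_of_mul_le_mul_right this (by positivity)
  rwa [← div_eq_mul_inv, div_le_iff₀ (by positivity)]

lemma exists_lt_sum_eulerWeight (C : ℝ) : ∃ M : ℕ, 0 < M ∧ ∃ s₀ : ℕ, ∀ s ≥ s₀, C <
    (∑ p ∈ range (2 ^ (M * s) + 1) with p.Prime, eulerWeight p) -
      ∑ p ∈ range (2 ^ s + 1) with p.Prime, eulerWeight p := by
  obtain ⟨j₀, hj₀⟩ := sum_eulerWeight_dyadic_le
  obtain ⟨M, hM, hM0⟩ := (((tendsto_log_atTop.comp tendsto_natCast_atTop_atTop).eventually_gt_atTop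
    (4 * C + 1)).and (eventually_gt_atTop 0)).exists
  simp only [Function.comp] at hM
  refine ⟨M, hM0, max j₀ 1, fun s hs => ?_⟩
  have hs1 : 1 ≤ s := (le_max_right _ _).trans hs
  have hsj : j₀ ≤ s := (le_max_left _ _).trans hs
  have key : ∀ k ≥ s, (1 / 4 : ℝ) * ((harmonic k : ℝ) - harmonic s) ≤
      (∑ p ∈ range (2 ^ k + 1) with p.Prime, eulerWeight p) -
      ∑ p ∈ range (2 ^ s + 1) with p.Prime, eulerWeight p := by
    intro k hk
    induction k, hk using Nat.le_induction with
    | base => simp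
    | succ k hk ih =>
      have := hj₀ k (hsj.trans hk)
      rw [harmonic_succ]
      push_cast
      linarith
  refine lt_of_lt_of_le ?_ (key (M * s) (Nat.le_mul_of_pos_left s hM0))
  have h1 := log_add_one_le_harmonic (M * s)
  have h2 := harmonic_le_one_add_log s
  have h3 : log M + log s ≤ log ((M * s + 1 : ℕ) : ℝ) := by
    rw [← log_mul (by positivity) (by positivity)]
    refine log_le_log (by positivity) ?_
    push_cast; linarith
  linarith

variable {h : ℕ} [NeZero h]

lemma tendsto_greedyLoad_sub (i j : Fin h) :
    Tendsto (fun n : ℕ => (greedyLoad h n i - greedyLoad h n j) * log n) atTop (𝓝 0) := by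
  obtain ⟨M, hM, s₀, hs₀⟩ := exists_lt_sum_eulerWeight (h * (2 * eulerWeight 2))
  have hb : ∀ s ≥ s₀, ∀ n, 2 ^ (M * s) < n → ∀ i j : Fin h,
      greedyLoad h n i - greedyLoad h n j ≤ 2 * ((2 : ℝ) ^ s)⁻¹ := by
    intro s hs n hn i j
    have hy : 2 ≤ 2 ^ s + 1 := by have := Nat.one_le_two_pow (n := s); omega
    have h1 : 2 ^ s ≤ 2 ^ (M * s) := Nat.pow_le_pow_right two_pos (Nat.le_mul_of_pos_left s hM)
    have h2 := greedyLoad_le_add_of_lt (h := h) hy (by omega : 2 ^ s + 1 ≤ n)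
      ((hs₀ s hs).trans_le (sub_le_sub_right ?_ _)) i j
    · have h3 := eulerWeight_le hy
      have h4 : ((2 ^ s + 1 : ℕ) : ℝ)⁻¹ ≤ ((2 : ℝ) ^ s)⁻¹ := by
        refine inv_anti₀ (by positivity) ?_
        push_cast; linarith
      linarith
    · refine sum_le_sum_of_subset_of_nonneg (filter_subset_filter _ (range_mono hn))
        fun p hp _ => (eulerWeight_pos (mem_filter.1 hp).2.two_le).le
  have hlog : Tendsto (fun n : ℕ => Nat.log 2 (n - 1) / M) atTop atTop := by
    refine tendsto_atTop.2 fun b => ?_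
    filter_upwards [eventually_gt_atTop (2 ^ (b * M))] with n hn
    rw [Nat.le_div_iff_mul_le hM]
    exact Nat.le_log_of_pow_le one_lt_two (by omega)
  have hlim : Tendsto (fun s : ℕ => 2 * ((2 : ℝ) ^ s)⁻¹ * (M * (s + 1) + 1)) atTop (𝓝 0) := by
    have e1 := tendsto_pow_const_div_const_pow_of_one_lt 1 (one_lt_two (α := ℝ))
    have e2 := tendsto_pow_const_div_const_pow_of_one_lt 0 (one_lt_two (α := ℝ))
    have := (e1.const_mul (2 * M : ℝ)).add (e2.const_mul (2 * (M + 1) : ℝ))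
    simp only [mul_zero, add_zero] at this
    refine this.congr fun s => ?_
    simp only [pow_one, pow_zero]
    ring
  refine squeeze_zero_norm' ?_ (hlim.comp hlog)
  filter_upwards [hlog.eventually_ge_atTop s₀, eventually_ge_atTop 2] with n hn hn2
  set s := Nat.log 2 (n - 1) / M with hsdef
  have h1 : 2 ^ (M * s) < n := by
    have : 2 ^ (M * s) ≤ n - 1 :=
      (Nat.pow_le_pow_right two_pos (Nat.mul_div_le _ M)).trans (Nat.pow_log_le_self 2 (by omega))
    omega
  have h2 : log n ≤ M * (s + 1) + 1 := by
    have h3 : n - 1 < 2 ^ (Nat.log 2 (n - 1) + 1) := Nat.lt_pow_succ_log_self one_lt_two _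
    have h4 : Nat.log 2 (n - 1) < M * (s + 1) := by
      rw [hsdef, mul_comm]; exact Nat.lt_mul_of_div_lt (Nat.lt_succ_self _) hM
    have h5 : n ≤ 2 ^ (M * (s + 1) + 1) :=
      (by omega : n ≤ 2 ^ (Nat.log 2 (n - 1) + 1)).trans
        (Nat.pow_le_pow_right two_pos (by omega))
    calc log n ≤ log (2 ^ (M * (s + 1) + 1)) := by
          refine log_le_log (by positivity) (by exact_mod_cast h5)
      _ = (M * (s + 1) + 1) * log 2 := by rw [log_pow]; push_cast; ring
      _ ≤ (M * (s + 1) + 1) * 1 := by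
          gcongr
          have := log_two_lt_d9
          linarith
      _ = _ := mul_one _
  have h6 : 0 ≤ log n := log_natCast_nonneg n
  rw [norm_mul, Real.norm_of_nonneg h6]
  have h7 : ‖greedyLoad h n i - greedyLoad h n j‖ ≤ 2 * ((2 : ℝ) ^ s)⁻¹ := by
    rw [Real.norm_eq_abs, abs_le]
    have := hb s hn n h1 i j
    have := hb s hn n h1 j i
    constructor <;> linarith
  simp only [Function.comp]
  gcongr

end PrimeSums

section ColoredIntegers
open Topology Finset

lemma sum_range_mul_sub_eq (b D : ℕ → ℝ) (N : ℕ) :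
    ∑ k ∈ range N, b k * (D (k + 1) - D k) =
      b N * D N - b 0 * D 0 - ∑ k ∈ range N, (b (k + 1) - b k) * D (k + 1) := by
  induction N with
  | zero => simp
  | succ N ih => rw [sum_range_succ, sum_range_succ, ih]; ring

lemma tendsto_sum_mul_sub_div {b D : ℕ → ℝ} (hb : Monotone b) (hb0 : b 0 = 0)
    (hb1 : ∀ n : ℕ, b n ≤ n * log n) (hD : Tendsto (fun n : ℕ => D n * log n) atTop (𝓝 0)) :
    Tendsto (fun N : ℕ => (∑ k ∈ range N, b k * (D (k + 1) - D k)) / N) atTop (𝓝 0) := by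
  have hbn : ∀ n, 0 ≤ b n := fun n => hb0 ▸ hb (Nat.zero_le n)
  have hlog1 : ∀ᶠ n : ℕ in atTop, 1 ≤ log n :=
    (tendsto_log_atTop.comp tendsto_natCast_atTop_atTop).eventually_ge_atTop 1
  have hD0 : Tendsto D atTop (𝓝 0) := by
    refine squeeze_zero_norm' ?_ (by simpa only [norm_zero] using hD.norm)
    filter_upwards [hlog1] with n hn
    rw [norm_mul, Real.norm_of_nonneg (by linarith : 0 ≤ log n)]
    exact le_mul_of_one_le_right (norm_nonneg _) hn
  obtain ⟨B, hB⟩ := (Metric.isBounded_range_of_tendsto _ hD0).exists_norm_le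
  have hB' : ∀ n, |D n| ≤ B := fun n => hB _ ⟨n, rfl⟩
  have hBn : 0 ≤ B := (abs_nonneg _).trans (hB' 0)
  have hsqrt : Tendsto Nat.sqrt atTop atTop := by
    refine tendsto_atTop.2 fun k => ?_
    filter_upwards [eventually_ge_atTop (k * k)] with n hn using Nat.le_sqrt.2 hn
  have hmlog : Tendsto (fun m : ℕ => log m / m) atTop (𝓝 0) :=
    (isLittleO_log_id_atTop.tendsto_div_nhds_zero).comp tendsto_natCast_atTop_atTop
  rw [Metric.tendsto_atTop']
  intro ε' hε'
  set ε := ε' / 16 with hεdef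
  have hε : 0 < ε := by positivity
  have hDε : ∀ᶠ n : ℕ in atTop, ∀ k ≥ n, |D k| * log k ≤ ε := by
    obtain ⟨K, hK⟩ := eventually_atTop.1 (hD.norm.eventually_le_const (by simpa using hε))
    refine eventually_atTop.2 ⟨K, fun n hn k hk => ?_⟩
    have := hK k (hn.trans hk)
    rwa [norm_mul, Real.norm_eq_abs, Real.norm_of_nonneg (log_natCast_nonneg k)] at this
  have hBm := (hmlog.const_mul B).eventually_le_const (by simpa using hε : B * 0 < ε)
  obtain ⟨K, hK⟩ := eventually_atTop.1 ((hsqrt.eventually (hDε.and (hBm.and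
    (hlog1.and (eventually_ge_atTop 2))))).and (eventually_gt_atTop 0))
  refine ⟨K, fun N hN => ?_⟩
  obtain ⟨⟨h1, h2, h3, h4⟩, hN0⟩ := hK N hN.le
  set m := Nat.sqrt N with hm
  have hmN : m * m ≤ N := Nat.sqrt_le N
  have hmN' : m ≤ N := (Nat.le_mul_self m).trans hmN
  have hNm : N < (m + 1) * (m + 1) := Nat.lt_succ_sqrt N
  have hm0 : (0 : ℝ) < m := by positivity
  have hNpos : (0 : ℝ) < N := by positivity
  have hlm : 0 < log m := by linarith
  have hlogN : log N ≤ 4 * log m := by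
    have : N ≤ m ^ 4 := by
      have : m + 1 ≤ m * m := by nlinarith
      calc N ≤ (m + 1) * (m + 1) := hNm.le
        _ ≤ (m * m) * (m * m) := Nat.mul_le_mul this this
        _ = _ := by ring
    calc log N ≤ log ((m : ℝ) ^ 4) := log_le_log hNpos (by exact_mod_cast this)
      _ = _ := by rw [log_pow]; norm_num
  have hbN : b N * (ε / log m) ≤ 4 * ε * N := by
    have : b N ≤ N * (4 * log m) := (hb1 N).trans (by gcongr)
    calc _ ≤ N * (4 * log m) * (ε / log m) := by gcongr
      _ = _ := by field_simp
  have hDk : ∀ k ≥ m, |D k| ≤ ε / log m := by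
    intro k hk
    rw [le_div_iff₀ hlm]
    refine le_trans ?_ (h1 k hk)
    gcongr
  have hsum : ∀ n ≥ m, |∑ k ∈ range n, (b (k + 1) - b k) * D (k + 1)| ≤
      B * b m + (b n - b m) * (ε / log m) := by
    intro n hn
    induction n, hn using Nat.le_induction with
    | base =>
      refine (abs_sum_le_sum_abs _ _).trans ?_
      calc _ ≤ ∑ k ∈ range m, (b (k + 1) - b k) * B := by
            refine sum_le_sum fun k _ => ?_
            have := hb (Nat.le_succ k)
            rw [abs_mul, abs_of_nonneg (by simpa using this)]
            exact mul_le_mul_of_nonneg_left (hB' _) (by simpa using this)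
        _ = _ := by rw [← sum_mul, sum_range_sub, hb0]; ring
    | succ n hn ih =>
      rw [sum_range_succ]
      refine (abs_add_le _ _).trans ?_
      have h5 : 0 ≤ b (n + 1) - b n := sub_nonneg.2 (hb (Nat.le_succ n))
      rw [abs_mul, abs_of_nonneg h5]
      have h6 := mul_le_mul_of_nonneg_left (hDk (n + 1) (by omega)) h5
      linarith
  have h7 := hsum N hmN'
  have h8 : B * b m ≤ ε * N := by
    have : B * (m * log m) ≤ ε * N := by
      have e : (m : ℝ) * m ≤ N := by exact_mod_cast hmN
      have e' : B * log m ≤ ε * m := by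
        rw [← mul_div_assoc, div_le_iff₀ hm0] at h2; exact h2
      nlinarith
    exact (mul_le_mul_of_nonneg_left (hb1 m) hBn).trans this
  have h9 : |b N * D N| ≤ 4 * ε * N := by
    rw [abs_mul, abs_of_nonneg (hbn N)]
    exact (mul_le_mul_of_nonneg_left (hDk N hmN') (hbn N)).trans hbN
  have h10 : 0 ≤ b m * (ε / log m) := mul_nonneg (hbn m) (by positivity)
  rw [dist_zero_right, norm_div, Real.norm_natCast, div_lt_iff₀ hNpos, sum_range_mul_sub_eq, hb0,
    zero_mul, sub_zero, Real.norm_eq_abs]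
  refine (abs_sub _ _).trans_lt ?_
  have h11 : ε' * N = 16 * (ε * N) := by rw [hεdef]; ring
  have h12 : 0 < ε * N := mul_pos hε hNpos
  linarith

variable {h : ℕ}

open Classical in
/-- The indicator function of the positive integers all of whose prime factors have colour `i`,
as a completely multiplicative function. -/
noncomputable def colorInd (χ : ℕ → Fin h) (i : Fin h) : ℕ →*₀ ℝ where
  toFun n := if n ≠ 0 ∧ ∀ p, p.Prime → p ∣ n → χ p = i then 1 else 0
  map_zero' := by simp
  map_one' := by
    rw [if_pos]
    exact ⟨one_ne_zero, fun p hp h1 => absurd (Nat.dvd_one.1 h1) hp.ne_one⟩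
  map_mul' m n := by
    rw [ite_zero_mul_ite_zero, mul_one]
    refine if_congr ⟨?_, ?_⟩ rfl rfl
    · rintro ⟨h0, hp⟩
      exact ⟨⟨left_ne_zero_of_mul h0, fun p h1 h2 => hp p h1 (h2.mul_right n)⟩,
        right_ne_zero_of_mul h0, fun p h1 h2 => hp p h1 (h2.mul_left m)⟩
    · rintro ⟨⟨h0, hp⟩, h0', hp'⟩
      exact ⟨mul_ne_zero h0 h0', fun p h1 h2 =>
        ((Nat.Prime.dvd_mul h1).1 h2).elim (hp p h1) (hp' p h1)⟩

open Classical in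
lemma colorInd_apply (χ : ℕ → Fin h) (i : Fin h) (n : ℕ) : colorInd χ i n =
    if n ≠ 0 ∧ ∀ p, p.Prime → p ∣ n → χ p = i then 1 else 0 := rfl

open Classical in
lemma colorInd_prime (χ : ℕ → Fin h) (i : Fin h) {p : ℕ} (hp : p.Prime) :
    colorInd χ i p = if χ p = i then 1 else 0 := by
  rw [colorInd_apply]
  refine if_congr ⟨fun h1 => h1.2 p hp dvd_rfl, fun h1 => ⟨hp.ne_zero, fun q hq hqp => ?_⟩⟩ rfl rfl
  rwa [(Nat.prime_dvd_prime_iff_eq hq hp).1 hqp]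

lemma colorInd_nonneg (χ : ℕ → Fin h) (i : Fin h) (n : ℕ) : 0 ≤ colorInd χ i n := by
  rw [colorInd_apply]; split_ifs <;> norm_num

lemma colorInd_le_one (χ : ℕ → Fin h) (i : Fin h) (n : ℕ) : colorInd χ i n ≤ 1 := by
  rw [colorInd_apply]; split_ifs <;> norm_num

lemma sum_colorInd_prime (χ : ℕ → Fin h) {p : ℕ} (hp : p.Prime) :
    ∑ i, colorInd χ i p = 1 := by
  simp [colorInd_prime χ _ hp]

lemma greedyLoad_eq_sum_colorInd [NeZero h] (n : ℕ) (i : Fin h) : greedyLoad h n i =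
    ∑ p ∈ range n with p.Prime, colorInd (greedyColor h) i p * eulerWeight p := by
  rw [greedyLoad_eq_sum, sum_filter]
  refine sum_congr rfl fun p _ => ?_
  by_cases hp : p.Prime
  · simp [hp, colorInd_prime]
  · simp [hp]

lemma greedyLoad_succ_sub [NeZero h] (n : ℕ) (i : Fin h) :
    greedyLoad h (n + 1) i - greedyLoad h n i =
    if n.Prime then colorInd (greedyColor h) i n * eulerWeight n else 0 := by
  rw [greedyLoad_eq_sum_colorInd, greedyLoad_eq_sum_colorInd, sum_filter, sum_filter,
    sum_range_succ, add_sub_cancel_left]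

lemma monotone_log_div_eulerWeight : Monotone fun n : ℕ => log n / eulerWeight n := by
  intro m n hmn
  simp only
  rcases Nat.lt_or_ge m 2 with hm | hm
  · have h0 : log m / eulerWeight m = 0 := by
      interval_cases m <;> simp
    rw [h0]
    rcases Nat.lt_or_ge n 2 with hn | hn
    · interval_cases n <;> simp
    · exact div_nonneg (log_natCast_nonneg n) (eulerWeight_pos hn).le
  · have hn := hm.trans hmn
    exact div_le_div₀ (log_natCast_nonneg n) (log_le_log (by positivity) (by exact_mod_cast hmn))
      (eulerWeight_pos hn) (eulerWeight_anti hm hmn)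

lemma log_div_eulerWeight_le (n : ℕ) : log n / eulerWeight n ≤ n * log n := by
  rcases Nat.lt_or_ge n 2 with hn | hn
  · interval_cases n <;> simp
  · rw [div_le_iff₀ (eulerWeight_pos hn)]
    have h1 : 1 ≤ n * eulerWeight n := by
      have := inv_le_eulerWeight hn
      rwa [inv_le_iff_one_le_mul₀' (by positivity)] at this
    have := log_natCast_nonneg n
    nlinarith

variable [NeZero h]

lemma tendsto_sum_colorInd_log_sub (i j : Fin h) : Tendsto (fun N : ℕ =>
    ((∑ p ∈ range N with p.Prime, colorInd (greedyColor h) i p * log p) -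
      ∑ p ∈ range N with p.Prime, colorInd (greedyColor h) j p * log p) / N) atTop (𝓝 0) := by
  refine (tendsto_sum_mul_sub_div monotone_log_div_eulerWeight (by simp) log_div_eulerWeight_le
    (tendsto_greedyLoad_sub i j)).congr fun N => ?_
  congr 1
  rw [← sum_sub_distrib, sum_filter]
  refine sum_congr rfl fun p _ => ?_
  rw [show ∀ a b c d : ℝ, a - b - (c - d) = (a - c) - (b - d) by intros; ring,
    greedyLoad_succ_sub, greedyLoad_succ_sub]
  split_ifs with hp
  · have := (eulerWeight_pos hp.two_le).ne'
    field_simp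
  · simp

lemma tendsto_sum_colorInd_log (i : Fin h) : Tendsto (fun N : ℕ =>
    (∑ p ∈ range (N + 1) with p.Prime, colorInd (greedyColor h) i p * log p) / N) atTop
      (𝓝 (1 / h)) := by
  set T : Fin h → ℕ → ℝ := fun j N => ∑ p ∈ range (N + 1) with p.Prime,
    colorInd (greedyColor h) j p * log p with hT
  have hN1 : Tendsto (fun N : ℕ => ((N + 1 : ℕ) : ℝ) / N) atTop (𝓝 1) := by
    have : Tendsto (fun N : ℕ => (1 : ℝ) + (N : ℝ)⁻¹) atTop (𝓝 (1 + 0)) :=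
      tendsto_const_nhds.add tendsto_inv_atTop_nhds_zero_nat
    rw [add_zero] at this
    refine this.congr' ?_
    filter_upwards [eventually_gt_atTop 0] with N hN
    push_cast; field_simp
  have h1 : ∀ j, Tendsto (fun N : ℕ => (T i N - T j N) / N) atTop (𝓝 0) := by
    intro j
    have := ((tendsto_sum_colorInd_log_sub i j).comp (tendsto_add_atTop_nat 1)).mul hN1
    rw [zero_mul] at this
    refine this.congr fun N => ?_
    simp only [Function.comp]
    rw [div_mul_div_comm, mul_comm ((N + 1 : ℕ) : ℝ) (N : ℝ),
      mul_div_mul_right _ _ (by positivity)]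
  have h2 : Tendsto (fun N : ℕ => (∑ j, T j N) / N) atTop (𝓝 1) := by
    refine (tendsto_theta_div.comp tendsto_natCast_atTop_atTop).congr fun N => ?_
    simp only [Function.comp, theta_natCast, hT]
    rw [sum_comm]
    congr 1
    refine sum_congr rfl fun p hp => ?_
    rw [← sum_mul, sum_colorInd_prime _ (mem_filter.1 hp).2, one_mul]
  have h3 := (h2.add (tendsto_finsetSum univ fun j _ => h1 j)).const_mul (1 / (h : ℝ))
  simp only [sum_const_zero, add_zero, mul_one] at h3
  refine h3.congr fun N => ?_
  have hh : (h : ℝ) ≠ 0 := by exact_mod_cast NeZero.ne h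
  rw [← sum_div, sum_sub_distrib]
  simp only [sum_const, card_univ, Fintype.card_fin, nsmul_eq_mul]
  field_simp
  ring

lemma tendsto_sum_colorInd_vonMangoldt (i : Fin h) : Tendsto (fun N : ℕ =>
    (∑ n ∈ range (N + 1), colorInd (greedyColor h) i n * ArithmeticFunction.vonMangoldt n) / N) atTop
      (𝓝 (1 / h)) := by
  have h1 := (tendsto_psi_div.sub tendsto_theta_div).comp tendsto_natCast_atTop_atTop
  have h2 := (tendsto_sum_colorInd_log i).add h1
  simp only [sub_self, add_zero] at h2
  have key : ∀ N : ℕ, ∀ n ∈ range (N + 1), (if n.Prime then log n else 0) ≤ ArithmeticFunction.vonMangoldt n := by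
    intro N n _
    split_ifs with hp
    · rw [ArithmeticFunction.vonMangoldt_apply_prime hp]
    · exact ArithmeticFunction.vonMangoldt_nonneg
  refine tendsto_of_tendsto_of_tendsto_of_le_of_le (tendsto_sum_colorInd_log i) h2 ?_ ?_
  · intro N
    refine div_le_div_of_nonneg_right ?_ (Nat.cast_nonneg N)
    rw [sum_filter]
    refine sum_le_sum fun n hn => ?_
    have := mul_le_mul_of_nonneg_left (key N n hn) (colorInd_nonneg (greedyColor h) i n)
    split_ifs at this ⊢ <;> simpa using this
  · intro N
    simp only [Function.comp]
    rw [← sub_div, ← add_div]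
    refine div_le_div_of_nonneg_right ?_ (Nat.cast_nonneg N)
    rw [theta_natCast, Chebyshev.psi_eq_sum_Icc, Nat.floor_natCast,
      ← Ico_add_one_right_eq_Icc, ← range_eq_Ico, sum_filter, sum_filter, ← sum_sub_distrib,
      ← sum_add_distrib]
    refine sum_le_sum fun n hn => ?_
    have h3 := mul_le_mul_of_nonneg_right (colorInd_le_one (greedyColor h) i n)
      (sub_nonneg.2 (key N n hn))
    split_ifs at h3 ⊢ <;> linarith

end ColoredIntegers

section EulerProducts
open Topology Finset

lemma abs_sum_Ico_mul_sub_le {b D : ℕ → ℝ} {K : ℕ} {ε : ℝ} (hb : ∀ k ≥ K, b (k + 1) ≤ b k)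
    (hb0 : ∀ k ≥ K, 0 ≤ b k) (hD : ∀ k ≥ K, |D k| ≤ ε) {N : ℕ} (hN : K ≤ N) :
    |∑ k ∈ Ico K N, b k * (D (k + 1) - D k)| ≤ 2 * ε * b K := by
  have key : |∑ k ∈ Ico K N, b k * (D (k + 1) - D k) - b N * D N + b K * D K| ≤
      ε * (b K - b N) := by
    induction N, hN using Nat.le_induction with
    | base => simp
    | succ N hN ih =>
      rw [sum_Ico_succ_top hN]
      have h1 : |(b N - b (N + 1)) * D (N + 1)| ≤ (b N - b (N + 1)) * ε := by
        rw [abs_mul, abs_of_nonneg (sub_nonneg.2 (hb N hN))]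
        exact mul_le_mul_of_nonneg_left (hD _ (by omega)) (sub_nonneg.2 (hb N hN))
      rw [abs_le] at ih h1 ⊢
      constructor <;> linarith
  have h1 : |b N * D N| ≤ b N * ε := by
    rw [abs_mul, abs_of_nonneg (hb0 N hN)]
    exact mul_le_mul_of_nonneg_left (hD _ hN) (hb0 N hN)
  have h2 : |b K * D K| ≤ b K * ε := by
    rw [abs_mul, abs_of_nonneg (hb0 K le_rfl)]
    exact mul_le_mul_of_nonneg_left (hD _ le_rfl) (hb0 K le_rfl)
  rw [abs_le] at *
  constructor <;> linarith

/-- The completely multiplicative function `n ↦ f n * n ^ (-s)`. -/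
noncomputable def rpowTwist (f : ℕ →*₀ ℝ) (s : ℝ) : ℕ →*₀ ℝ where
  toFun n := f n * (n : ℝ) ^ (-s)
  map_zero' := by simp
  map_one' := by simp
  map_mul' m n := by
    rw [map_mul, Nat.cast_mul, mul_rpow (Nat.cast_nonneg m) (Nat.cast_nonneg n)]; ring

lemma rpowTwist_apply (f : ℕ →*₀ ℝ) (s : ℝ) (n : ℕ) :
    rpowTwist f s n = f n * (n : ℝ) ^ (-s) := rfl

lemma summable_rpowTwist {f : ℕ →*₀ ℝ} (hf0 : ∀ n, 0 ≤ f n) (hf : ∀ n, f n ≤ 1) {s : ℝ}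
    (hs : 1 < s) : Summable (rpowTwist f s) := by
  refine Summable.of_nonneg_of_le (fun n => ?_) (fun n => ?_)
    (summable_nat_rpow.2 (neg_lt_neg hs))
  · exact mul_nonneg (hf0 n) (rpow_nonneg (Nat.cast_nonneg n) _)
  · exact mul_le_of_le_one_left (rpow_nonneg (Nat.cast_nonneg n) _) (hf n)

lemma one_le_tsum_rpowTwist {f : ℕ →*₀ ℝ} (hf0 : ∀ n, 0 ≤ f n) (hf : ∀ n, f n ≤ 1) {s : ℝ}
    (hs : 1 < s) : 1 ≤ ∑' n, rpowTwist f s n := by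
  have := (summable_rpowTwist hf0 hf hs).le_tsum 1
    fun n _ => mul_nonneg (hf0 n) (rpow_nonneg (Nat.cast_nonneg n) _)
  simpa using this

lemma natCast_rpow_neg_le_inv {n : ℕ} (hn : 1 ≤ n) {s : ℝ} (hs : 1 ≤ s) :
    (n : ℝ) ^ (-s) ≤ (n : ℝ)⁻¹ := by
  rw [← rpow_neg_one]
  exact rpow_le_rpow_of_exponent_le (by exact_mod_cast hn) (by linarith)

lemma abs_neg_log_one_sub_sub_le {y z : ℝ} (hy : 0 ≤ y) (hyz : y ≤ z) (hz : z ≤ 1 / 2) :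
    0 ≤ -log (1 - y) - y ∧ -log (1 - y) - y ≤ 2 * z ^ 2 := by
  have h1 : 0 < 1 - y := by linarith
  have h2 := log_le_sub_one_of_pos h1
  have h3 := one_sub_inv_le_log_of_pos h1
  refine ⟨by linarith, ?_⟩
  have h4 : (1 - y)⁻¹ ≤ 1 + y + 2 * y ^ 2 := by
    rw [inv_le_iff_one_le_mul₀ h1]; nlinarith [mul_nonneg hy hy]
  nlinarith

lemma abs_eulerWeight_mul_rpow_sub_le {n : ℕ} (hn : 2 ≤ n) {δ : ℝ} (hδ : 0 ≤ δ) :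
    |eulerWeight n * (n : ℝ) ^ (-δ) - -log (1 - (n : ℝ) ^ (-(1 + δ)))| ≤ 2 * ((n : ℝ) ^ 2)⁻¹ := by
  have h2 : (2 : ℝ) ≤ n := by exact_mod_cast hn
  have hz : (n : ℝ)⁻¹ ≤ 1 / 2 := by rw [one_div]; exact inv_anti₀ two_pos h2
  have hz0 : 0 ≤ (n : ℝ)⁻¹ := by positivity
  obtain ⟨h3, h4⟩ := abs_neg_log_one_sub_sub_le (by positivity)
    (natCast_rpow_neg_le_inv (by omega) (by linarith : 1 ≤ 1 + δ)) hz
  obtain ⟨h5, h6⟩ := abs_neg_log_one_sub_sub_le hz0 le_rfl hz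
  rw [inv_pow] at h4 h6
  change 0 ≤ eulerWeight n - (n : ℝ)⁻¹ at h5
  change eulerWeight n - (n : ℝ)⁻¹ ≤ _ at h6
  have h7 : (n : ℝ) ^ (-(1 + δ)) = (n : ℝ)⁻¹ * (n : ℝ) ^ (-δ) := by
    rw [neg_add, rpow_add (by linarith), rpow_neg_one]
  have h8 : (n : ℝ) ^ (-δ) ≤ 1 := rpow_le_one_of_one_le_of_nonpos (by linarith) (by linarith)
  have h9 : 0 ≤ (n : ℝ) ^ (-δ) := by positivity
  have h10 : 0 ≤ (eulerWeight n - (n : ℝ)⁻¹) * (n : ℝ) ^ (-δ) := mul_nonneg h5 h9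
  have h11 := mul_le_of_le_one_right h5 h8
  rw [abs_le]
  constructor <;> nlinarith

lemma tendsto_tsum_abs_eulerWeight_mul_rpow_sub : Tendsto (fun δ : ℝ => ∑' n : ℕ,
    if n.Prime then |eulerWeight n * (n : ℝ) ^ (-δ) - -log (1 - (n : ℝ) ^ (-(1 + δ)))| else 0)
    (𝓝[>] 0) (𝓝 0) := by
  have := tendsto_tsum_of_dominated_convergence (𝓕 := 𝓝[>] (0 : ℝ))
    (f := fun (δ : ℝ) (n : ℕ) => if n.Prime then
      |eulerWeight n * (n : ℝ) ^ (-δ) - -log (1 - (n : ℝ) ^ (-(1 + δ)))| else 0)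
    (g := fun _ => 0) (bound := fun n : ℕ => 2 * ((n : ℝ) ^ 2)⁻¹)
    ((summable_nat_pow_inv.2 one_lt_two).mul_left 2) ?_ ?_
  · simpa using this
  · intro n
    by_cases hn : n.Prime
    · simp only [hn, if_true]
      have h2 : (2 : ℝ) ≤ n := by exact_mod_cast hn.two_le
      have hz : (n : ℝ)⁻¹ ≤ 2⁻¹ := inv_anti₀ two_pos h2
      have hc : ContinuousAt (fun δ : ℝ =>
          |eulerWeight n * (n : ℝ) ^ (-δ) - -log (1 - (n : ℝ) ^ (-(1 + δ)))|) 0 := by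
        have e1 : ContinuousAt (fun δ : ℝ => (n : ℝ) ^ (-δ)) 0 :=
          ContinuousAt.rpow continuousAt_const (by fun_prop) (Or.inl (by positivity))
        have e2 : ContinuousAt (fun δ : ℝ => (n : ℝ) ^ (-(1 + δ))) 0 :=
          ContinuousAt.rpow continuousAt_const (by fun_prop) (Or.inl (by positivity))
        refine ((e1.const_mul _).sub ((continuousAt_const.sub e2).log ?_).neg).abs
        have : 0 < 1 - (n : ℝ)⁻¹ := by linarith
        change 1 - (n : ℝ) ^ (-(1 + (0 : ℝ))) ≠ 0
        rw [add_zero, rpow_neg_one]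
        exact this.ne'
      have := hc.tendsto.mono_left (nhdsWithin_le_nhds (s := Set.Ioi (0 : ℝ)))
      simpa [eulerWeight, rpow_neg_one] using this
    · simp [hn]
  · filter_upwards [self_mem_nhdsWithin] with δ hδ n
    split_ifs with hn
    · rw [norm_abs_eq_norm]
      exact abs_eulerWeight_mul_rpow_sub_le hn.two_le (le_of_lt hδ)
    · simp

variable {h : ℕ} [NeZero h]

lemma eventually_abs_sum_mul_rpow_le {D : ℕ → ℝ} (hD : Tendsto D atTop (𝓝 0)) (hD1 : D 1 = 0)
    {ε : ℝ} (hε : 0 < ε) : ∀ᶠ δ : ℝ in 𝓝[>] 0, ∀ᶠ N : ℕ in atTop,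
      |∑ k ∈ Ico 1 N, (k : ℝ) ^ (-δ) * (D (k + 1) - D k)| ≤ ε := by
  obtain ⟨K, hK⟩ := eventually_atTop.1 ((hD.abs.eventually_le_const
    (by simpa using hε : |(0 : ℝ)| < ε / 4)).and (eventually_ge_atTop 1))
  have hK1 : 1 ≤ K := (hK K le_rfl).2
  have hc : Tendsto (fun δ : ℝ => ∑ k ∈ Ico 1 K, (k : ℝ) ^ (-δ) * (D (k + 1) - D k)) (𝓝[>] 0)
      (𝓝 (D K)) := by
    have e : D K = ∑ k ∈ Ico 1 K, (k : ℝ) ^ (-0 : ℝ) * (D (k + 1) - D k) := by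
      simp only [neg_zero, rpow_zero, one_mul]
      rw [sum_Ico_sub D hK1, hD1, sub_zero]
    rw [e]
    refine tendsto_finsetSum _ fun k hk => ?_
    have hk0 : (k : ℝ) ≠ 0 := by
      have := (mem_Ico.1 hk).1
      positivity
    have : ContinuousAt (fun δ : ℝ => (k : ℝ) ^ (-δ) * (D (k + 1) - D k)) 0 :=
      (ContinuousAt.rpow continuousAt_const (by fun_prop) (Or.inl hk0)).mul continuousAt_const
    exact this.tendsto.mono_left nhdsWithin_le_nhds
  have h1 := hc.abs.eventually_lt_const
    ((hK K le_rfl).1.trans_lt (by linarith : ε / 4 < ε / 2))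
  filter_upwards [h1, self_mem_nhdsWithin] with δ h2 hδ
  have hδ0 : 0 < δ := hδ
  filter_upwards [eventually_ge_atTop K] with N hN
  rw [← sum_Ico_consecutive _ hK1 hN]
  refine (abs_add_le _ _).trans ?_
  have h3 := abs_sum_Ico_mul_sub_le (b := fun k : ℕ => (k : ℝ) ^ (-δ)) (D := D) (K := K)
    (ε := ε / 4) (fun k hk => rpow_le_rpow_of_nonpos (by have := hK1.trans hk; positivity)
      (by push_cast; linarith) (by linarith)) (fun k _ => by positivity) (fun k hk => (hK k hk).1) hN
  have h4 : (K : ℝ) ^ (-δ) ≤ 1 :=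
    rpow_le_one_of_one_le_of_nonpos (by exact_mod_cast hK1) (by linarith)
  nlinarith

lemma greedyLoad_one (i : Fin h) : greedyLoad h 1 i = 0 := by
  simp [greedyLoad, Nat.not_prime_zero]

lemma tendsto_greedyLoad_sub_zero (i j : Fin h) :
    Tendsto (fun n : ℕ => greedyLoad h n i - greedyLoad h n j) atTop (𝓝 0) := by
  refine squeeze_zero_norm' ?_ (by simpa only [norm_zero] using (tendsto_greedyLoad_sub i j).norm)
  filter_upwards [(tendsto_log_atTop.comp tendsto_natCast_atTop_atTop).eventually_ge_atTop 1]
    with n hn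
  simp only [Function.comp] at hn
  rw [norm_mul, Real.norm_of_nonneg (by linarith : 0 ≤ log n)]
  exact le_mul_of_one_le_right (norm_nonneg _) hn

/-- The Dirichlet series of the integers of colour `i` at `1 + δ`. -/
noncomputable def colorSeries (h : ℕ) [NeZero h] (i : Fin h) (δ : ℝ) : ℝ :=
  ∑' n, rpowTwist (colorInd (greedyColor h) i) (1 + δ) n

lemma colorSeries_pos (i : Fin h) {δ : ℝ} (hδ : 0 < δ) : 0 < colorSeries h i δ :=
  one_pos.trans_le (one_le_tsum_rpowTwist (colorInd_nonneg _ i) (colorInd_le_one _ i)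
    (by linarith))

lemma tendsto_sum_log_colorSeries (i : Fin h) {δ : ℝ} (hδ : 0 < δ) :
    Tendsto (fun N => ∑ p ∈ range N with p.Prime, colorInd (greedyColor h) i p *
      -log (1 - (p : ℝ) ^ (-(1 + δ)))) atTop (𝓝 (log (colorSeries h i δ))) := by
  have h1 := EulerProduct.eulerProduct_completely_multiplicative
    (f := rpowTwist (colorInd (greedyColor h) i) (1 + δ))
    (summable_rpowTwist (colorInd_nonneg _ i) (colorInd_le_one _ i) (by linarith)).norm
  have h2 := (continuousAt_log (colorSeries_pos i hδ).ne').tendsto.comp h1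
  refine h2.congr fun N => ?_
  simp only [Function.comp]
  have hlt : ∀ p : ℕ, p.Prime → 0 < 1 - (p : ℝ) ^ (-(1 + δ)) := fun p hp => by
    have := natCast_rpow_neg_le_inv hp.one_le (by linarith : 1 ≤ 1 + δ)
    have h3 : (p : ℝ)⁻¹ < 1 := inv_lt_one_of_one_lt₀ (by exact_mod_cast hp.one_lt)
    linarith
  rw [log_prod]
  · refine sum_congr rfl fun p hp => ?_
    have hp' := (mem_filter.1 hp).2
    rw [rpowTwist_apply, colorInd_prime _ _ hp', log_inv]
    split_ifs <;> simp
  · intro p hp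
    have hp' := Nat.prime_of_mem_primesBelow hp
    rw [rpowTwist_apply, colorInd_prime _ _ hp']
    have := (hlt p hp').ne'
    split_ifs
    · simpa only [one_mul] using inv_ne_zero this
    · simp

lemma tendsto_log_colorSeries_sub (i j : Fin h) :
    Tendsto (fun δ => log (colorSeries h i δ) - log (colorSeries h j δ)) (𝓝[>] 0) (𝓝 0) := by
  rw [Metric.tendsto_nhds]
  intro ε hε
  have h1 := eventually_abs_sum_mul_rpow_le (tendsto_greedyLoad_sub_zero i j)
    (by simp [greedyLoad_one]) (by positivity : 0 < ε / 3)
  have h2 := tendsto_tsum_abs_eulerWeight_mul_rpow_sub.eventually_lt_const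
    (by positivity : 0 < ε / 3)
  filter_upwards [h1, h2, self_mem_nhdsWithin] with δ h3 h4 hδ
  have hδ0 : 0 < δ := hδ
  have h5 := ((tendsto_sum_log_colorSeries i hδ0).sub (tendsto_sum_log_colorSeries j hδ0)).abs
  rw [dist_zero_right, Real.norm_eq_abs]
  refine lt_of_le_of_lt (le_of_tendsto h5 ?_) (by linarith : ε / 3 + ε / 3 < ε)
  filter_upwards [h3, eventually_ge_atTop 1] with N h6 hN
  set R : ℕ → ℝ := fun n => eulerWeight n * (n : ℝ) ^ (-δ) - -log (1 - (n : ℝ) ^ (-(1 + δ)))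
    with hR
  have hsum : Summable fun n : ℕ => if n.Prime then |R n| else 0 := by
    refine Summable.of_nonneg_of_le (fun n => by positivity) (fun n => ?_)
      ((summable_nat_pow_inv.2 one_lt_two).mul_left (2 : ℝ))
    split_ifs with hn
    · exact abs_eulerWeight_mul_rpow_sub_le hn.two_le hδ0.le
    · positivity
  have h7 : ∑ n ∈ range N, (if n.Prime then |R n| else 0) ≤ ε / 3 :=
    (hsum.sum_le_tsum _ fun n _ => by positivity).trans h4.le
  have h8 : (∑ p ∈ range N with p.Prime, colorInd (greedyColor h) i p *
      -log (1 - (p : ℝ) ^ (-(1 + δ)))) - (∑ p ∈ range N with p.Prime,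
      colorInd (greedyColor h) j p * -log (1 - (p : ℝ) ^ (-(1 + δ)))) =
      (∑ k ∈ Ico 1 N, (k : ℝ) ^ (-δ) * ((greedyLoad h (k + 1) i - greedyLoad h (k + 1) j) -
        (greedyLoad h k i - greedyLoad h k j))) -
      ∑ p ∈ range N, if p.Prime then
        (colorInd (greedyColor h) i p - colorInd (greedyColor h) j p) * R p else 0 := by
    have e : ∑ k ∈ Ico 1 N, (k : ℝ) ^ (-δ) * ((greedyLoad h (k + 1) i - greedyLoad h (k + 1) j) -
        (greedyLoad h k i - greedyLoad h k j)) = ∑ k ∈ range N, (k : ℝ) ^ (-δ) *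
        ((greedyLoad h (k + 1) i - greedyLoad h (k + 1) j) -
        (greedyLoad h k i - greedyLoad h k j)) := by
      rw [range_eq_Ico, sum_eq_sum_Ico_succ_bot (by omega : 0 < N)]
      rw [zero_add, greedyLoad_one, greedyLoad_one]
      simp [greedyLoad]
    rw [e, sum_filter, sum_filter, ← sum_sub_distrib, ← sum_sub_distrib]
    refine sum_congr rfl fun k _ => ?_
    rw [show ∀ a b c d : ℝ, a - b - (c - d) = (a - c) - (b - d) by intros; ring,
      greedyLoad_succ_sub, greedyLoad_succ_sub]
    split_ifs with hk
    · simp only [hR]; ring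
    · ring
  rw [h8]
  refine (abs_sub _ _).trans (add_le_add h6 (le_trans ?_ h7))
  refine (abs_sum_le_sum_abs _ _).trans (sum_le_sum fun p _ => ?_)
  split_ifs with hp
  · rw [abs_mul]
    refine mul_le_of_le_one_left (abs_nonneg _) ?_
    have := colorInd_nonneg (greedyColor h) i p
    have := colorInd_nonneg (greedyColor h) j p
    have := colorInd_le_one (greedyColor h) i p
    have := colorInd_le_one (greedyColor h) j p
    rw [abs_le]; constructor <;> linarith
  · simp

lemma prod_colorSeries {δ : ℝ} (hδ : 0 < δ) :
    ∏ i, colorSeries h i δ = ∑' n : ℕ, 1 / (n : ℝ) ^ (1 + δ) := by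
  have h1 : HasProd (fun p : Nat.Primes => ∏ i,
      (1 - rpowTwist (colorInd (greedyColor h) i) (1 + δ) p)⁻¹) (∏ i, colorSeries h i δ) :=
    hasProd_prod fun i _ => EulerProduct.eulerProduct_completely_multiplicative_hasProd
      (summable_rpowTwist (colorInd_nonneg _ i) (colorInd_le_one _ i) (by linarith)).norm
  let f : ℕ →*₀ ℝ :=
    { toFun := fun n => if n = 0 then 0 else 1
      map_zero' := by simp
      map_one' := by simp
      map_mul' := fun m n => by by_cases hm : m = 0 <;> by_cases hn : n = 0 <;> simp [hm, hn] }
  have hf : ∀ n, f n = if n = 0 then 0 else 1 := fun n => rfl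
  have h2 := EulerProduct.eulerProduct_completely_multiplicative_hasProd (f := rpowTwist f (1 + δ))
    (summable_rpowTwist (fun n => by rw [hf]; positivity)
      (fun n => by rw [hf]; split_ifs <;> norm_num) (by linarith)).norm
  have h3 : (fun p : Nat.Primes => ∏ i,
      (1 - rpowTwist (colorInd (greedyColor h) i) (1 + δ) p)⁻¹) =
      fun p : Nat.Primes => (1 - rpowTwist f (1 + δ) p)⁻¹ := by
    funext p
    rw [Finset.prod_eq_single (greedyColor h p)]
    · simp [rpowTwist_apply, colorInd_prime _ _ p.2, hf, p.2.ne_zero]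
    · intro i _ hi
      simp [rpowTwist_apply, colorInd_prime _ _ p.2, hi.symm]
    · simp
  rw [h3] at h1
  rw [h1.unique h2]
  refine tsum_congr fun n => ?_
  rw [rpowTwist_apply, hf]
  by_cases hn : n = 0
  · have : (1 : ℝ) + δ ≠ 0 := by positivity
    simp [hn, zero_rpow this]
  · rw [if_neg hn, one_mul, rpow_neg (Nat.cast_nonneg n), one_div]

lemma tendsto_rpow_mul_colorSeries (i : Fin h) :
    Tendsto (fun δ => δ ^ (1 / h : ℝ) * colorSeries h i δ) (𝓝[>] 0) (𝓝 1) := by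
  have hh : (h : ℝ) ≠ 0 := by exact_mod_cast NeZero.ne h
  have h1 : Tendsto (fun δ : ℝ => δ * ∏ j, colorSeries h j δ) (𝓝[>] 0) (𝓝 1) := by
    have e : Tendsto (fun δ : ℝ => 1 + δ) (𝓝[>] 0) (𝓝[>] 1) := by
      refine tendsto_nhdsWithin_iff.2 ⟨?_, ?_⟩
      · have : ContinuousAt (fun δ : ℝ => 1 + δ) 0 := by fun_prop
        simpa using this.tendsto.mono_left (nhdsWithin_le_nhds (s := Set.Ioi (0 : ℝ)))
      · filter_upwards [self_mem_nhdsWithin] with δ hδ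
        simpa using hδ
    refine (tendsto_sub_mul_tsum_nat_rpow.comp e).congr' ?_
    filter_upwards [self_mem_nhdsWithin] with δ hδ
    rw [prod_colorSeries hδ]
    simp
  have h2 : Tendsto (fun δ : ℝ => ∏ j, exp (log (colorSeries h i δ) - log (colorSeries h j δ)))
      (𝓝[>] 0) (𝓝 1) := by
    have := tendsto_finsetProd (univ : Finset (Fin h)) fun j _ =>
      (continuous_exp.tendsto 0).comp (tendsto_log_colorSeries_sub i j)
    simpa using this
  have h3 := (h1.mul h2).rpow_const (p := (1 / h : ℝ)) (Or.inl (by norm_num))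
  rw [mul_one, one_rpow] at h3
  refine h3.congr' ?_
  filter_upwards [self_mem_nhdsWithin] with δ hδ
  have hp := fun j : Fin h => colorSeries_pos j hδ
  have hδ0 : (0 : ℝ) < δ := hδ
  simp only [exp_sub, exp_log (hp _)]
  rw [mul_assoc, ← prod_mul_distrib]
  simp only [mul_div_cancel₀ _ (hp _).ne']
  rw [prod_const, card_univ, Fintype.card_fin, mul_rpow hδ0.le (by positivity [hp i]),
    ← rpow_natCast, ← rpow_mul (hp i).le]
  rw [mul_one_div_cancel hh, rpow_one]

end EulerProducts

section Karamata
open Topology Set MeasureTheory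

lemma summable_mul_of_abs_le {W z : ℕ → ℝ} {C : ℝ} (hW : ∀ n, 0 ≤ W n) (hs : Summable W)
    (hz : ∀ n, |z n| ≤ C) : Summable fun n => W n * z n := by
  refine Summable.of_norm_bounded (hs.mul_right C) fun n => ?_
  rw [norm_mul, Real.norm_of_nonneg (hW n)]
  exact mul_le_mul_of_nonneg_left (hz n) (hW n)

lemma ContinuousOn.exists_abs_le {g : ℝ → ℝ} (hg : ContinuousOn g (Icc 0 1)) :
    ∃ C, ∀ x ∈ Icc (0 : ℝ) 1, |g x| ≤ C := isCompact_Icc.exists_bound_of_continuousOn hg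

lemma integrableOn_mul_comp_exp_neg {K g : ℝ → ℝ} (hK : IntegrableOn K (Ioi 0))
    (hg : Continuous g) : IntegrableOn (fun t => K t * g (exp (-t))) (Ioi 0) := by
  obtain ⟨C, hC⟩ := hg.continuousOn.exists_abs_le
  refine hK.mul_bdd (c := C) (by fun_prop) ?_
  refine (ae_restrict_mem measurableSet_Ioi).mono fun t ht => hC _ ⟨(exp_pos _).le, ?_⟩
  rw [exp_le_one_iff]
  linarith [mem_Ioi.1 ht]

section Moments
variable {ι : Type*} {l : Filter ι} {W y : ι → ℕ → ℝ} {K : ℝ → ℝ}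

lemma tendsto_tsum_mul_polynomial (hK : IntegrableOn K (Ioi 0))
    (hW : ∀ᶠ i in l, (∀ n, 0 ≤ W i n) ∧ Summable (W i) ∧ ∀ n, y i n ∈ Icc (0 : ℝ) 1)
    (hmom : ∀ k : ℕ, Tendsto (fun i => ∑' n, W i n * y i n ^ k) l
      (𝓝 (∫ t in Ioi 0, K t * exp (-t) ^ k))) (p : Polynomial ℝ) :
    Tendsto (fun i => ∑' n, W i n * p.eval (y i n)) l
      (𝓝 (∫ t in Ioi 0, K t * p.eval (exp (-t)))) := by
  induction p using Polynomial.induction_on' with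
  | add p q hp hq =>
    simp only [Polynomial.eval_add, mul_add]
    rw [integral_add (integrableOn_mul_comp_exp_neg hK p.continuous)
      (integrableOn_mul_comp_exp_neg hK q.continuous)]
    refine (hp.add hq).congr' ?_
    filter_upwards [hW] with i hi
    obtain ⟨C, hC⟩ := p.continuous.continuousOn.exists_abs_le
    obtain ⟨C', hC'⟩ := q.continuous.continuousOn.exists_abs_le
    exact ((summable_mul_of_abs_le hi.1 hi.2.1 fun n => hC _ (hi.2.2 n)).tsum_add
      (summable_mul_of_abs_le hi.1 hi.2.1 fun n => hC' _ (hi.2.2 n))).symm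
  | monomial k c =>
    simp only [Polynomial.eval_monomial, mul_left_comm _ c, tsum_mul_left, integral_const_mul]
    exact (hmom k).const_mul c

lemma tendsto_tsum_mul_continuous (hK : IntegrableOn K (Ioi 0)) (hK0 : ∀ t ∈ Ioi (0 : ℝ), 0 ≤ K t)
    (hW : ∀ᶠ i in l, (∀ n, 0 ≤ W i n) ∧ Summable (W i) ∧ ∀ n, y i n ∈ Icc (0 : ℝ) 1)
    (hmom : ∀ k : ℕ, Tendsto (fun i => ∑' n, W i n * y i n ^ k) l
      (𝓝 (∫ t in Ioi 0, K t * exp (-t) ^ k))) {g : ℝ → ℝ} (hg : Continuous g) :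
    Tendsto (fun i => ∑' n, W i n * g (y i n)) l (𝓝 (∫ t in Ioi 0, K t * g (exp (-t)))) := by
  set M := ∫ t in Ioi 0, K t with hM
  have hM0 : 0 ≤ M := setIntegral_nonneg measurableSet_Ioi hK0
  have h0 : Tendsto (fun i => ∑' n, W i n) l (𝓝 M) := by simpa using hmom 0
  rw [Metric.tendsto_nhds]
  intro ε hε
  set η := ε / (2 * M + 3) with hη
  have hη0 : 0 < η := by positivity
  obtain ⟨p, hp⟩ := exists_polynomial_near_of_continuousOn 0 1 g hg.continuousOn η hη0
  have h1 := Metric.tendsto_nhds.1 (tendsto_tsum_mul_polynomial hK hW hmom p) η hη0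
  filter_upwards [h1, h0.eventually_lt_const (lt_add_one M), hW] with i h2 h3 hi
  obtain ⟨C, hC⟩ := p.continuous.continuousOn.exists_abs_le
  obtain ⟨C', hC'⟩ := hg.continuousOn.exists_abs_le
  have s1 := summable_mul_of_abs_le hi.1 hi.2.1 fun n => hC _ (hi.2.2 n)
  have s2 := summable_mul_of_abs_le hi.1 hi.2.1 fun n => hC' _ (hi.2.2 n)
  have h4 : |(∑' n, W i n * g (y i n)) - ∑' n, W i n * p.eval (y i n)| ≤ (M + 1) * η := by
    rw [← s2.tsum_sub s1, ← Real.norm_eq_abs]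
    refine (tsum_of_norm_bounded (hi.2.1.hasSum.mul_right η) fun n => ?_).trans
      (mul_le_mul_of_nonneg_right h3.le hη0.le)
    rw [← mul_sub, norm_mul, Real.norm_of_nonneg (hi.1 n), Real.norm_eq_abs, abs_sub_comm]
    exact mul_le_mul_of_nonneg_left (hp _ (hi.2.2 n)).le (hi.1 n)
  have h5 : |(∫ t in Ioi 0, K t * p.eval (exp (-t))) - ∫ t in Ioi 0, K t * g (exp (-t))| ≤
      M * η := by
    rw [← integral_sub (integrableOn_mul_comp_exp_neg hK p.continuous)
      (integrableOn_mul_comp_exp_neg hK hg), ← Real.norm_eq_abs, hM, ← integral_mul_const]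
    refine norm_integral_le_of_norm_le (hK.mul_const η) ?_
    refine (ae_restrict_mem measurableSet_Ioi).mono fun t ht => ?_
    rw [← mul_sub, norm_mul, Real.norm_of_nonneg (hK0 t ht), Real.norm_eq_abs]
    refine mul_le_mul_of_nonneg_left (hp _ ⟨(exp_pos _).le, ?_⟩).le (hK0 t ht)
    rw [exp_le_one_iff]
    linarith [mem_Ioi.1 ht]
  rw [Real.dist_eq] at h2 ⊢
  have h6 : (2 * M + 3) * η = ε := by rw [hη]; field_simp
  calc _ ≤ (M + 1) * η + η + M * η := by
        rw [abs_le] at *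
        rw [abs_lt] at h2
        constructor <;> linarith
    _ < ε := by rw [← h6]; linarith

/-- The ramp rising from `0` at `c` to `1` at `c + η`. -/
noncomputable def ramp (c η x : ℝ) : ℝ := max 0 (min 1 ((x - c) / η))

lemma continuous_ramp (c η : ℝ) : Continuous (ramp c η) := by unfold ramp; fun_prop

lemma ramp_nonneg (c η x : ℝ) : 0 ≤ ramp c η x := le_max_left _ _

lemma ramp_le_one (c η x : ℝ) : ramp c η x ≤ 1 := max_le zero_le_one (min_le_left _ _)

lemma ramp_eq_zero {c η x : ℝ} (hη : 0 < η) (h : x ≤ c) : ramp c η x = 0 :=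
  max_eq_left ((min_le_right _ _).trans (div_nonpos_of_nonpos_of_nonneg (by linarith) hη.le))

lemma ramp_eq_one {c η x : ℝ} (hη : 0 < η) (h : c + η ≤ x) : ramp c η x = 1 := by
  rw [ramp, min_eq_left, max_eq_right zero_le_one]
  rw [one_le_div hη]; linarith

lemma tendsto_tsum_mul_step (hK : IntegrableOn K (Ioi 0)) (hK0 : ∀ t ∈ Ioi (0 : ℝ), 0 ≤ K t)
    (hW : ∀ᶠ i in l, (∀ n, 0 ≤ W i n) ∧ Summable (W i) ∧ ∀ n, y i n ∈ Icc (0 : ℝ) 1)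
    (hmom : ∀ k : ℕ, Tendsto (fun i => ∑' n, W i n * y i n ^ k) l
      (𝓝 (∫ t in Ioi 0, K t * exp (-t) ^ k))) :
    Tendsto (fun i => ∑' n, W i n * (if exp (-1) ≤ y i n then (y i n)⁻¹ else 0)) l
      (𝓝 (∫ t in Ioc 0 1, K t * exp t)) := by
  set c := exp (-1) with hc
  have hc0 : 0 < c := exp_pos _
  set k : ℝ → ℝ := fun x => (max x c)⁻¹ with hk
  have hkc : Continuous k :=
    (continuous_id.max continuous_const).inv₀ fun x => (hc0.trans_le (le_max_right _ _)).ne'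
  have hk0 : ∀ x, 0 ≤ k x := fun x => inv_nonneg.2 (hc0.le.trans (le_max_right _ _))
  have hkb : ∀ x, k x ≤ c⁻¹ := fun x => inv_anti₀ hc0 (le_max_right _ _)
  have hky : ∀ x, c ≤ x → k x = x⁻¹ := fun x hx => by simp only [hk, max_eq_left hx]
  have hkt : ∀ t, t ≤ 1 → k (exp (-t)) = exp t := fun t ht => by
    rw [hky _ (exp_le_exp.2 (by linarith)), exp_neg, inv_inv]
  have hint : ∀ d : ℝ → ℝ,
      (∀ t, t < 1 → ∀ᶠ η in 𝓝[>] 0, ramp (d η) η (exp (-t)) = 1) →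
      (∀ t, 1 < t → ∀ᶠ η in 𝓝[>] 0, ramp (d η) η (exp (-t)) = 0) →
      Tendsto (fun η => ∫ t in Ioi 0, K t * (k (exp (-t)) * ramp (d η) η (exp (-t)))) (𝓝[>] 0)
        (𝓝 (∫ t in Ioc 0 1, K t * exp t)) := by
    intro d hd1 hd0
    have e : ∫ t in Ioc 0 1, K t * exp t =
        ∫ t in Ioi 0, (Ioc 0 1).indicator (fun t => K t * exp t) t := by
      rw [setIntegral_indicator measurableSet_Ioc, inter_eq_right.2 Ioc_subset_Ioi_self]
    rw [e]
    refine tendsto_integral_filter_of_dominated_convergence (fun t => K t * c⁻¹) ?_ ?_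
      (hK.mul_const _) ?_
    · exact Eventually.of_forall fun η => (integrableOn_mul_comp_exp_neg hK
        (hkc.mul (continuous_ramp (d η) η))).aestronglyMeasurable
    · refine Eventually.of_forall fun η => ?_
      refine (ae_restrict_mem measurableSet_Ioi).mono fun t ht => ?_
      rw [norm_mul, Real.norm_of_nonneg (hK0 t ht),
        Real.norm_of_nonneg (mul_nonneg (hk0 _) (ramp_nonneg _ _ _))]
      refine mul_le_mul_of_nonneg_left ?_ (hK0 t ht)
      exact (mul_le_of_le_one_right (hk0 _) (ramp_le_one _ _ _)).trans (hkb _)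
    · have hne : ∀ᵐ t ∂volume.restrict (Ioi (0 : ℝ)), t ≠ 1 :=
        ae_restrict_of_ae (Measure.ae_ne volume 1)
      filter_upwards [hne, ae_restrict_mem measurableSet_Ioi] with t ht ht0
      refine tendsto_const_nhds.congr' ?_
      rcases lt_or_gt_of_ne ht with h1 | h1
      · filter_upwards [hd1 t h1] with η hη
        rw [hη, indicator_of_mem (show t ∈ Ioc (0 : ℝ) 1 from ⟨ht0, h1.le⟩), hkt t h1.le, mul_one]
      · filter_upwards [hd0 t h1] with η hη
        rw [hη, indicator_of_notMem (show t ∉ Ioc (0 : ℝ) 1 from fun h2 => h2.2.not_gt h1), mul_zero, mul_zero]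
  have hup := hint (fun η => c - η) (fun t ht => by
      filter_upwards [self_mem_nhdsWithin] with η hη
      exact ramp_eq_one hη (by simpa [hc] using ht.le)) (fun t ht => by
      have : exp (-t) < c := exp_lt_exp.2 (by linarith)
      filter_upwards [Ioo_mem_nhdsGT (sub_pos.2 this)] with η hη
      exact ramp_eq_zero hη.1 (by linarith [hη.2]))
  have hlo := hint (fun _ => c) (fun t ht => by
      have : c < exp (-t) := exp_lt_exp.2 (by linarith)
      filter_upwards [Ioo_mem_nhdsGT (sub_pos.2 this)] with η hη
      exact ramp_eq_one hη.1 (by linarith [hη.2])) (fun t ht => by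
      filter_upwards [self_mem_nhdsWithin] with η hη
      exact ramp_eq_zero hη (exp_le_exp.2 (by linarith)))
  have hcont : ∀ d η : ℝ, Continuous fun x => k x * ramp d η x :=
    fun d η => hkc.mul (continuous_ramp d η)
  have hstep : ∀ x, |if c ≤ x then x⁻¹ else 0| ≤ c⁻¹ := fun x => by
    split_ifs with hx
    · rw [abs_of_pos (inv_pos.2 (hc0.trans_le hx))]; exact inv_anti₀ hc0 hx
    · rw [abs_zero]; positivity
  have hramp : ∀ d η x, |k x * ramp d η x| ≤ c⁻¹ := fun d η x => by
    rw [abs_of_nonneg (mul_nonneg (hk0 _) (ramp_nonneg _ _ _))]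
    exact (mul_le_of_le_one_right (hk0 _) (ramp_le_one _ _ _)).trans (hkb _)
  refine tendsto_order.2 ⟨fun a ha => ?_, fun a ha => ?_⟩
  · obtain ⟨η, h1, h2⟩ := ((hlo.eventually_const_lt ha).and self_mem_nhdsWithin).exists
    have hη : 0 < η := h2
    filter_upwards [(tendsto_tsum_mul_continuous hK hK0 hW hmom (hcont c η)).eventually_const_lt h1,
      hW] with i h3 hi
    refine h3.trans_le (Summable.tsum_le_tsum (fun n => mul_le_mul_of_nonneg_left ?_ (hi.1 n))
      (summable_mul_of_abs_le hi.1 hi.2.1 fun n => hramp _ _ _)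
      (summable_mul_of_abs_le hi.1 hi.2.1 fun n => hstep _))
    split_ifs with h4
    · rw [hky _ h4]
      exact mul_le_of_le_one_right (inv_nonneg.2 (hi.2.2 n).1) (ramp_le_one _ _ _)
    · rw [ramp_eq_zero hη (not_le.1 h4).le, mul_zero]
  · obtain ⟨η, h1, h2⟩ := ((hup.eventually_lt_const ha).and self_mem_nhdsWithin).exists
    have hη : 0 < η := h2
    filter_upwards [(tendsto_tsum_mul_continuous hK hK0 hW hmom
      (hcont (c - η) η)).eventually_lt_const h1, hW] with i h3 hi
    refine lt_of_le_of_lt (Summable.tsum_le_tsum (fun n => mul_le_mul_of_nonneg_left ?_ (hi.1 n))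
      (summable_mul_of_abs_le hi.1 hi.2.1 fun n => hstep _)
      (summable_mul_of_abs_le hi.1 hi.2.1 fun n => hramp _ _ _)) h3
    split_ifs with h4
    · rw [hky _ h4, ramp_eq_one hη (by linarith), mul_one]
    · exact mul_nonneg (hk0 _) (ramp_nonneg _ _ _)

end Moments

end Karamata

section ColorCount
open Topology Finset
open Set (Ioi Ioc Icc)
open MeasureTheory (IntegrableOn)

variable {τ : ℝ}

/-- The density of the Gamma distribution of shape `τ`. -/
noncomputable def gammaKernel (τ t : ℝ) : ℝ := t ^ (τ - 1) * exp (-t) / Gamma τ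

lemma gammaKernel_nonneg (hτ : 0 < τ) {t : ℝ} (ht : t ∈ Ioi (0 : ℝ)) : 0 ≤ gammaKernel τ t :=
  div_nonneg (mul_nonneg (rpow_nonneg (le_of_lt ht) _) (exp_pos _).le) (Gamma_pos_of_pos hτ).le

lemma integrableOn_gammaKernel (hτ : 0 < τ) : IntegrableOn (gammaKernel τ) (Ioi 0) := by
  refine ((Real.GammaIntegral_convergent hτ).div_const (Gamma τ)).congr ?_
  exact Eventually.of_forall fun t => by simp only [gammaKernel]; ring

lemma integral_gammaKernel_mul_exp_pow (hτ : 0 < τ) (k : ℕ) :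
    ∫ t in Ioi 0, gammaKernel τ t * exp (-t) ^ k = ((k + 1 : ℝ)⁻¹) ^ τ := by
  have h1 := Real.integral_rpow_mul_exp_neg_mul_Ioi hτ (by positivity : (0 : ℝ) < k + 1)
  have h2 : ∀ t, gammaKernel τ t * exp (-t) ^ k =
      t ^ (τ - 1) * exp (-((k + 1) * t)) / Gamma τ := fun t => by
    rw [gammaKernel, ← exp_nat_mul, div_mul_eq_mul_div, mul_assoc, ← exp_add]
    ring_nf
  simp only [h2]
  rw [MeasureTheory.integral_div, h1, mul_div_cancel_right₀ _ (Gamma_pos_of_pos hτ).ne', one_div]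

lemma integral_gammaKernel_mul_exp (hτ : 0 < τ) :
    ∫ t in Ioc 0 1, gammaKernel τ t * exp t = (Gamma (τ + 1))⁻¹ := by
  have h2 : ∀ t, gammaKernel τ t * exp t = t ^ (τ - 1) / Gamma τ := fun t => by
    rw [gammaKernel, div_mul_eq_mul_div, mul_assoc, ← exp_add]; simp
  simp only [h2]
  rw [MeasureTheory.integral_div, ← intervalIntegral.integral_of_le zero_le_one,
    integral_rpow (Or.inl (by linarith)), Gamma_add_one hτ.ne']
  simp [zero_rpow hτ.ne']
  field_simp

variable {h : ℕ} [NeZero h]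

lemma tendsto_sum_colorInd_div (i : Fin h) : Tendsto (fun N : ℕ =>
    (∑ n ∈ range (N + 1), colorInd (greedyColor h) i n / n) / log N ^ (1 / h : ℝ)) atTop
      (𝓝 (Gamma (1 / h + 1))⁻¹) := by
  have hτ : (0 : ℝ) < 1 / h := by
    have : (0 : ℝ) < h := by exact_mod_cast NeZero.pos h
    positivity
  set τ : ℝ := 1 / h with hτdef
  set a := colorInd (greedyColor h) i with ha
  have ha0 : ∀ n, 0 ≤ a n := colorInd_nonneg _ i
  have key := tendsto_tsum_mul_step (l := 𝓝[>] (0 : ℝ)) (K := gammaKernel τ)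
    (W := fun δ n => δ ^ τ * rpowTwist a (1 + δ) n) (y := fun δ n => (n : ℝ) ^ (-δ))
    (integrableOn_gammaKernel hτ) (fun t => gammaKernel_nonneg hτ) ?_ ?_
  · rw [integral_gammaKernel_mul_exp hτ] at key
    have hlog : Tendsto (fun N : ℕ => (log N)⁻¹) atTop (𝓝[>] 0) :=
      tendsto_inv_atTop_nhdsGT_zero.comp (tendsto_log_atTop.comp tendsto_natCast_atTop_atTop)
    refine (key.comp hlog).congr' ?_
    filter_upwards [eventually_ge_atTop 2] with N hN
    have hN' : 0 < log N := log_pos (by exact_mod_cast hN)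
    have hcond : ∀ n : ℕ, n ≠ 0 → (exp (-1) ≤ (n : ℝ) ^ (-(log N)⁻¹) ↔ n < N + 1) := by
      intro n hn
      have hn0 : (0 : ℝ) < n := by positivity
      rw [rpow_def_of_pos hn0, exp_le_exp, mul_neg, neg_le_neg_iff, ← div_eq_mul_inv,
        div_le_one hN', log_le_log_iff hn0 (by positivity), Nat.lt_succ_iff, Nat.cast_le]
    simp only [Function.comp]
    rw [tsum_eq_sum (s := range (N + 1)), sum_div]
    · refine sum_congr rfl fun n hn => ?_
      rcases eq_or_ne n 0 with rfl | hn0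
      · simp [rpowTwist_apply]
      have hn1 : (0 : ℝ) < n := by positivity
      rw [if_pos ((hcond n hn0).2 (mem_range.1 hn)), rpowTwist_apply, neg_add, rpow_add hn1,
        rpow_neg_one, inv_rpow hN'.le]
      have := (rpow_pos_of_pos hn1 (-(log N)⁻¹)).ne'
      field_simp
    · intro n hn
      rcases eq_or_ne n 0 with rfl | hn0
      · simp [rpowTwist_apply]
      rw [if_neg (fun h1 => hn (mem_range.2 ((hcond n hn0).1 h1))), mul_zero]
  · filter_upwards [self_mem_nhdsWithin] with δ hδ
    have hδ : 0 < δ := hδ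
    refine ⟨fun n => mul_nonneg (rpow_nonneg hδ.le _) (mul_nonneg (ha0 n) (by positivity)),
      (summable_rpowTwist ha0 (colorInd_le_one _ i) (by linarith)).mul_left _,
      fun n => ⟨by positivity, ?_⟩⟩
    rcases eq_or_ne n 0 with rfl | hn0
    · simp [zero_rpow (neg_ne_zero.2 hδ.ne')]
    · exact rpow_le_one_of_one_le_of_nonpos (by exact_mod_cast Nat.one_le_iff_ne_zero.2 hn0)
        (by linarith)
  · intro k
    rw [integral_gammaKernel_mul_exp_pow hτ]
    have hk : (0 : ℝ) < k + 1 := by positivity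
    have e : Tendsto (fun δ : ℝ => (k + 1) * δ) (𝓝[>] 0) (𝓝[>] 0) := by
      refine tendsto_nhdsWithin_iff.2 ⟨?_, ?_⟩
      · have : ContinuousAt (fun δ : ℝ => (k + 1) * δ) 0 := by fun_prop
        simpa using this.tendsto.mono_left (nhdsWithin_le_nhds (s := Ioi (0 : ℝ)))
      · filter_upwards [self_mem_nhdsWithin] with δ hδ
        exact mul_pos hk hδ
    have h1 := ((tendsto_rpow_mul_colorSeries i).comp e).const_mul (((k + 1 : ℝ)⁻¹) ^ τ)
    rw [mul_one, ← hτdef] at h1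
    refine h1.congr' ?_
    filter_upwards [self_mem_nhdsWithin] with δ hδ
    have hδ : 0 < δ := hδ
    simp only [Function.comp]
    rw [mul_rpow hk.le hδ.le, ← mul_assoc, ← mul_assoc, ← mul_rpow (by positivity) hk.le,
      inv_mul_cancel₀ hk.ne', one_rpow, one_mul, colorSeries, ← tsum_mul_left]
    refine tsum_congr fun n => ?_
    rw [mul_assoc, rpowTwist_apply, rpowTwist_apply, mul_assoc, ← rpow_mul_natCast (by positivity)]
    rcases eq_or_ne n 0 with rfl | hn0
    · simp
    rw [← rpow_add (by positivity), ha]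
    ring_nf

end ColorCount

section CountFromMean
open Topology Finset
open ArithmeticFunction (vonMangoldt)

lemma sum_mul_log_eq (a : ℕ →*₀ ℝ) (N : ℕ) : ∑ n ∈ Ioc 0 N, a n * log n =
    ∑ n ∈ Ioc 0 N, a n * ∑ m ∈ Ioc 0 (N / n), a m * vonMangoldt m := by
  obtain ⟨f, hf⟩ : ∃ f : ArithmeticFunction ℝ, ∀ n, f n = a n := ⟨⟨a, map_zero a⟩, fun _ => rfl⟩
  obtain ⟨g, hg⟩ : ∃ g : ArithmeticFunction ℝ, ∀ n, g n = f n * vonMangoldt n :=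
    ⟨⟨fun n => f n * vonMangoldt n, by simp⟩, fun _ => rfl⟩
  simp only [← hf, ← hg]
  rw [← ArithmeticFunction.sum_Ioc_mul_eq_sum_sum]
  refine sum_congr rfl fun n _ => ?_
  rw [ArithmeticFunction.mul_apply, ← ArithmeticFunction.vonMangoldt_sum, mul_sum,
    Nat.sum_divisorsAntidiagonal' (f := fun x y => f x * g y)]
  refine sum_congr rfl fun d hd => ?_
  rw [hg, ← mul_assoc, hf, hf, hf, ← map_mul, Nat.div_mul_cancel (Nat.dvd_of_mem_divisors hd)]

lemma mul_log_sub_le_sum_log (N : ℕ) : N * log N - N ≤ ∑ n ∈ Ioc 0 N, log n := by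
  induction N with
  | zero => simp
  | succ N ih =>
    rw [sum_Ioc_succ_top (Nat.zero_le N)]
    refine le_trans ?_ (add_le_add_left ih _)
    rcases Nat.eq_zero_or_pos N with rfl | hN
    · simp
    have hN0 : (0 : ℝ) < N := by exact_mod_cast hN
    have h1 : log ((N + 1 : ℝ) / N) ≤ (N + 1 : ℝ) / N - 1 := log_le_sub_one_of_pos (by positivity)
    rw [log_div (by positivity) hN0.ne'] at h1
    have h2 : (N : ℝ) * ((N + 1 : ℝ) / N - 1) = 1 := by field_simp; ring
    have h3 := mul_le_mul_of_nonneg_left h1 hN0.le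
    push_cast
    linarith

lemma sum_mul_log_bounds {a : ℕ → ℝ} (ha0 : ∀ n, 0 ≤ a n) (ha1 : ∀ n, a n ≤ 1) (N : ℕ) :
    0 ≤ (∑ n ∈ Ioc 0 N, a n) * log N - ∑ n ∈ Ioc 0 N, a n * log n ∧
    (∑ n ∈ Ioc 0 N, a n) * log N - ∑ n ∈ Ioc 0 N, a n * log n ≤ N := by
  have hl : ∀ n ∈ Ioc 0 N, 0 ≤ log N - log n := fun n hn => by
    rw [mem_Ioc] at hn
    exact sub_nonneg.2 (log_le_log (by exact_mod_cast hn.1) (by exact_mod_cast hn.2))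
  rw [sum_mul, ← sum_sub_distrib]
  simp only [← mul_sub]
  refine ⟨sum_nonneg fun n hn => mul_nonneg (ha0 n) (hl n hn), ?_⟩
  calc _ ≤ ∑ n ∈ Ioc 0 N, (log N - log n) :=
        sum_le_sum fun n hn => mul_le_of_le_one_left (hl n hn) (ha1 n)
    _ ≤ _ := by
        rw [sum_sub_distrib, sum_const, Nat.card_Ioc, nsmul_eq_mul]
        have := mul_log_sub_le_sum_log N
        simp only [Nat.sub_zero]
        linarith

lemma exists_abs_sub_mul_le {u : ℕ → ℝ} {τ ε : ℝ} (hε : 0 < ε)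
    (hu : Tendsto (fun N : ℕ => u N / N) atTop (𝓝 τ)) :
    ∃ C, 0 ≤ C ∧ ∀ n : ℕ, |u n - τ * n| ≤ ε * n + C := by
  obtain ⟨K, hK⟩ := eventually_atTop.1 (Metric.tendsto_nhds.1 hu ε hε)
  refine ⟨∑ n ∈ range (K + 1), |u n - τ * n|, sum_nonneg fun _ _ => abs_nonneg _, fun n => ?_⟩
  rcases Nat.lt_or_ge n (K + 1) with hn | hn
  · have := single_le_sum (f := fun n : ℕ => |u n - τ * n|) (fun _ _ => abs_nonneg _)
      (mem_range.2 hn)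
    have h2 : 0 ≤ ε * n := by positivity
    linarith
  · have h1 := (hK n (by omega)).le
    have hn0 : (0 : ℝ) < n := by exact_mod_cast (by omega : 0 < n)
    have h2 : u n / n - τ = (u n - τ * n) / n := by field_simp
    rw [Real.dist_eq, h2, abs_div, abs_of_pos hn0, div_le_iff₀ hn0] at h1
    have h3 : 0 ≤ ∑ n ∈ range (K + 1), |u n - τ * n| := sum_nonneg fun _ _ => abs_nonneg _
    linarith

lemma abs_sum_mul_div_sub_le {a u : ℕ → ℝ} {τ ε C : ℝ} (ha0 : ∀ n, 0 ≤ a n) (ha1 : ∀ n, a n ≤ 1)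
    (hτ : 0 ≤ τ) (hε : 0 ≤ ε) (hC : 0 ≤ C) (hu : ∀ n : ℕ, |u n - τ * n| ≤ ε * n + C) (N : ℕ) :
    |(∑ n ∈ Ioc 0 N, a n * u (N / n)) - τ * (N * ∑ n ∈ Ioc 0 N, a n / n)| ≤
      ε * (N * ∑ n ∈ Ioc 0 N, a n / n) + (C + τ) * N := by
  have h1 : ∀ n ∈ Ioc 0 N, |a n * u (N / n) - τ * (N * (a n / n))| ≤
      ε * (N * (a n / n)) + (C + τ) := by
    intro n hn
    have hn0 : (0 : ℝ) < n := by exact_mod_cast (mem_Ioc.1 hn).1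
    have h2 : ((N / n : ℕ) : ℝ) ≤ N / n := Nat.cast_div_le
    have h3 : (N : ℝ) / n < (N / n : ℕ) + 1 := by
      rw [div_lt_iff₀ hn0]
      exact_mod_cast (Nat.lt_mul_div_succ N (mem_Ioc.1 hn).1).trans_eq (mul_comm _ _)
    have h4 : |u (N / n) - τ * (N / n)| ≤ ε * (N / n) + (C + τ) := by
      have h5 := hu (N / n)
      have h6 := mul_le_mul_of_nonneg_left h2 hε
      have h7 := mul_le_mul_of_nonneg_left h2 hτ
      have h8 := mul_le_mul_of_nonneg_left h3.le hτ
      rw [abs_le] at h5 ⊢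
      constructor <;> linarith
    have h9 : a n * u (N / n) - τ * (N * (a n / n)) = a n * (u (N / n) - τ * (N / n)) := by
      ring
    rw [h9, abs_mul, abs_of_nonneg (ha0 n)]
    refine (mul_le_mul_of_nonneg_left h4 (ha0 n)).trans ?_
    have h10 := mul_le_of_le_one_left (add_nonneg hC hτ) (ha1 n)
    calc _ = ε * (N * (a n / n)) + a n * (C + τ) := by ring
      _ ≤ _ := by linarith
  rw [mul_sum, mul_sum, ← sum_sub_distrib]
  refine (abs_sum_le_sum_abs _ _).trans ((sum_le_sum h1).trans_eq ?_)
  rw [sum_add_distrib, sum_const, Nat.card_Ioc, nsmul_eq_mul, mul_sum]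
  simp only [Nat.sub_zero]
  ring

theorem tendsto_count_of_tendsto_mean {a : ℕ →*₀ ℝ} {τ c : ℝ} (ha0 : ∀ n, 0 ≤ a n)
    (ha1 : ∀ n, a n ≤ 1) (hτ : 0 < τ)
    (hψ : Tendsto (fun N : ℕ => (∑ n ∈ Ioc 0 N, a n * vonMangoldt n) / N) atTop (𝓝 τ))
    (hM : Tendsto (fun N : ℕ => (∑ n ∈ Ioc 0 N, a n / n) / log N ^ τ) atTop (𝓝 c)) :
    Tendsto (fun N : ℕ => (∑ n ∈ Ioc 0 N, a n) * log N ^ (1 - τ) / N) atTop (𝓝 (τ * c)) := by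
  have hlog : Tendsto (fun N : ℕ => log N) atTop atTop :=
    tendsto_log_atTop.comp tendsto_natCast_atTop_atTop
  have hlogτ : Tendsto (fun N : ℕ => (log N ^ τ)⁻¹) atTop (𝓝 0) :=
    ((tendsto_rpow_atTop hτ).comp hlog).inv_tendsto_atTop
  have hc0 : 0 ≤ c := ge_of_tendsto' hM fun N =>
    div_nonneg (sum_nonneg fun n _ => div_nonneg (ha0 n) (Nat.cast_nonneg n))
      (rpow_nonneg (log_natCast_nonneg N) _)
  have h1 : Tendsto (fun N : ℕ => ((∑ n ∈ Ioc 0 N, a n * log n) -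
      τ * (N * ∑ n ∈ Ioc 0 N, a n / n)) / (N * log N ^ τ)) atTop (𝓝 0) := by
    rw [Metric.tendsto_nhds]
    intro η hη
    set ε := η / (c + 3) with hε
    have hε0 : 0 < ε := by positivity
    obtain ⟨C, hC0, hC⟩ := exists_abs_sub_mul_le hε0 hψ
    filter_upwards [hM.eventually_lt_const (lt_add_one c),
      (hlogτ.const_mul (C + τ)).eventually_lt_const (by simpa using hε0 : (C + τ) * 0 < ε),
      hlog.eventually_gt_atTop 0, eventually_gt_atTop 0] with N h1 h2 h3 h4
    have hN : (0 : ℝ) < N := by exact_mod_cast h4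
    have hl : 0 < log N ^ τ := rpow_pos_of_pos h3 _
    have h5 := abs_sum_mul_div_sub_le ha0 ha1 hτ.le hε0.le hC0 hC N
    rw [← sum_mul_log_eq] at h5
    rw [dist_zero_right, norm_div, Real.norm_eq_abs, Real.norm_of_nonneg (by positivity),
      div_lt_iff₀ (by positivity)]
    refine h5.trans_lt ?_
    rw [div_lt_iff₀ hl] at h1
    rw [← div_eq_mul_inv, div_lt_iff₀ hl] at h2
    have h6 : ε * (N * ∑ n ∈ Ioc 0 N, a n / n) ≤ ε * (N * ((c + 1) * log N ^ τ)) := by gcongr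
    have h7 : (C + τ) * N ≤ ε * log N ^ τ * N := by gcongr
    have h8 : η * (N * log N ^ τ) = (c + 3) * ε * (N * log N ^ τ) := by rw [hε]; field_simp
    have h9 : 0 < ε * (N * log N ^ τ) := by positivity
    rw [h8]
    linarith
  have h2 : Tendsto (fun N : ℕ => ((∑ n ∈ Ioc 0 N, a n) * log N - ∑ n ∈ Ioc 0 N, a n * log n) /
      (N * log N ^ τ)) atTop (𝓝 0) := by
    refine squeeze_zero' ?_ ?_ hlogτ
    · filter_upwards with N
      exact div_nonneg (sum_mul_log_bounds ha0 ha1 N).1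
        (mul_nonneg (Nat.cast_nonneg N) (rpow_nonneg (log_natCast_nonneg N) _))
    · filter_upwards [hlog.eventually_gt_atTop 0, eventually_gt_atTop 0] with N h3 h4
      have hN : (0 : ℝ) < N := by exact_mod_cast h4
      have hl : 0 < log N ^ τ := rpow_pos_of_pos h3 _
      rw [div_le_iff₀ (by positivity)]
      refine (sum_mul_log_bounds ha0 ha1 N).2.trans_eq ?_
      field_simp
  have h3 := (h1.add h2).add (hM.const_mul τ)
  simp only [zero_add] at h3
  refine h3.congr' ?_
  filter_upwards [hlog.eventually_gt_atTop 0, eventually_gt_atTop 0] with N h3 h4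
  have hN : (0 : ℝ) < N := by exact_mod_cast h4
  have hl : 0 < log N ^ τ := rpow_pos_of_pos h3 _
  rw [rpow_sub h3, rpow_one]
  field_simp
  ring

variable {h : ℕ} [NeZero h]

lemma sum_range_succ_eq_sum_Ioc {f : ℕ → ℝ} (hf : f 0 = 0) (N : ℕ) :
    ∑ n ∈ range (N + 1), f n = ∑ n ∈ Ioc 0 N, f n := by
  rw [sum_range_succ', hf, add_zero, range_eq_Ico, sum_Ico_add' f 0 N 1]
  rfl

theorem tendsto_sum_colorInd (i : Fin h) : Tendsto (fun N : ℕ =>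
    (∑ n ∈ Ioc 0 N, colorInd (greedyColor h) i n) * log N ^ (1 - 1 / h : ℝ) / N) atTop
      (𝓝 (Gamma (1 / h))⁻¹) := by
  have hτ : (0 : ℝ) < 1 / h := by
    have : (0 : ℝ) < h := by exact_mod_cast NeZero.pos h
    positivity
  have h1 := tendsto_sum_colorInd_vonMangoldt i
  have h2 := tendsto_sum_colorInd_div i
  simp only [sum_range_succ_eq_sum_Ioc (f := fun n => colorInd (greedyColor h) i n *
    vonMangoldt n) (by simp)] at h1
  simp only [sum_range_succ_eq_sum_Ioc (f := fun n => colorInd (greedyColor h) i n /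
    n) (by simp)] at h2
  have h3 := tendsto_count_of_tendsto_mean (colorInd_nonneg _ i) (colorInd_le_one _ i) hτ h1 h2
  rwa [Gamma_add_one hτ.ne', mul_inv, mul_inv_cancel_left₀ hτ.ne'] at h3

end CountFromMean

section Basis
open Topology Finset

variable {h : ℕ}

/-- The positive integers whose prime factors all have the same colour. -/
def monochromatic (χ : ℕ → Fin h) : Set ℕ := {n | ∃ i, colorInd χ i n = 1}

lemma colorInd_eq_one_iff (χ : ℕ → Fin h) (i : Fin h) {n : ℕ} :
    colorInd χ i n = 1 ↔ n ≠ 0 ∧ ∀ p, p.Prime → p ∣ n → χ p = i := by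
  classical
  rw [colorInd_apply]
  split_ifs with h1
  · simpa using h1
  · simpa using h1

lemma isMB_monochromatic (χ : ℕ → Fin h) : IsMB h (monochromatic χ) := by
  intro n hn
  have hfin : {f : Fin h → ℕ | (∀ i, f i ∈ monochromatic χ) ∧ ∏ i, f i = n}.Finite := by
    refine (Set.Finite.pi' fun _ : Fin h => Set.finite_Iic n).subset fun f hf i => ?_
    exact Nat.le_of_dvd hn (hf.2 ▸ dvd_prod_of_mem f (mem_univ i))
  refine (Set.ncard_pos hfin).2
    ⟨fun i => ∏ p ∈ n.primeFactors with χ p = i, p ^ n.factorization p, fun i => ⟨i, ?_⟩, ?_⟩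
  · rw [map_prod]
    refine prod_eq_one fun p hp => ?_
    obtain ⟨hp, hi⟩ := mem_filter.1 hp
    rw [map_pow, colorInd_prime _ _ (Nat.prime_of_mem_primeFactors hp), if_pos hi, one_pow]
  · rw [prod_fiberwise]
    exact Nat.prod_factorization_pow_eq_self (by omega)

lemma sum_colorInd_eq (χ : ℕ → Fin h) {n : ℕ} (hn : 2 ≤ n)
    [Decidable (n ∈ monochromatic χ)] :
    ∑ i, colorInd χ i n = if n ∈ monochromatic χ then 1 else 0 := by
  have h0 : ∀ i, colorInd χ i n ≠ 1 → colorInd χ i n = 0 := fun i hi => by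
    classical
    rw [colorInd_apply] at hi ⊢
    split_ifs at hi ⊢ with h1
    · exact absurd rfl hi
    · rfl
  split_ifs with h1
  · obtain ⟨i, hi⟩ := h1
    rw [sum_eq_single i, hi]
    · intro j _ hj
      refine h0 j fun hj1 => hj ?_
      have h2 := Nat.minFac_prime (by omega : n ≠ 1)
      rw [colorInd_eq_one_iff] at hi hj1
      rw [← hi.2 _ h2 (Nat.minFac_dvd n), ← hj1.2 _ h2 (Nat.minFac_dvd n)]
    · simp
  · exact sum_eq_zero fun i _ => h0 i fun hi => h1 ⟨i, hi⟩

lemma cntF_monochromatic [NeZero h] (χ : ℕ → Fin h) {N : ℕ} (hN : 1 ≤ N) :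
    (cntF (monochromatic χ) N : ℝ) = (∑ i, ∑ n ∈ Ioc 0 N, colorInd χ i n) - (h - 1) := by
  classical
  have h1 : cntF (monochromatic χ) N = #{n ∈ Ioc 0 N | n ∈ monochromatic χ} := by
    rw [cntF, Nat.floor_natCast, ← Set.ncard_coe_finset]
    congr 1
    ext n
    simp only [Set.mem_inter_iff, Set.mem_Icc, coe_filter, mem_Ioc, Set.mem_ofPred_eq,
      Nat.succ_le_iff]
    tauto
  have h2 : (1 : ℕ) ∈ monochromatic χ := ⟨0, map_one _⟩
  have h3 : ∀ f : ℕ → ℝ, ∑ n ∈ Ioc 0 N, f n = f 1 + ∑ n ∈ Ioc 1 N, f n := fun f => by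
    rw [← Ioc_union_Ioc_eq_Ioc (Nat.zero_le 1) hN, sum_union (Ioc_disjoint_Ioc_of_le le_rfl)]
    simp
  rw [h1, card_filter, sum_comm, Nat.cast_sum, h3, h3,
    sum_congr rfl fun n hn => sum_colorInd_eq χ (mem_Ioc.1 hn).1]
  simp [h2, add_comm]

variable [NeZero h]

theorem tendsto_cntF_natCast : Tendsto (fun N : ℕ =>
    (cntF (monochromatic (greedyColor h)) N : ℝ) * log N ^ (1 - 1 / h : ℝ) / N) atTop
      (𝓝 (h / Gamma (1 / h))) := by
  have h1 := tendsto_finsetSum univ fun i _ => tendsto_sum_colorInd (h := h) i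
  have h2 : Tendsto (fun N : ℕ => log N ^ (1 - 1 / h : ℝ) / (N : ℝ)) atTop (𝓝 0) := by
    have := (isLittleO_log_rpow_rpow_atTop (1 - 1 / h : ℝ) one_pos).tendsto_div_nhds_zero.comp
      tendsto_natCast_atTop_atTop
    simpa [Function.comp_def] using this
  have h3 := h1.sub (h2.const_mul (h - 1 : ℝ))
  rw [sum_const, card_univ, Fintype.card_fin, nsmul_eq_mul, mul_zero, sub_zero,
    ← div_eq_mul_inv] at h3
  refine h3.congr' ?_
  filter_upwards [eventually_ge_atTop 1] with N hN
  rw [cntF_monochromatic _ hN, ← sum_div, ← sum_mul]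
  ring

lemma tendsto_log_div_log_floor : Tendsto (fun x : ℝ => log x / log ⌊x⌋₊) atTop (𝓝 1) := by
  have h1 : Tendsto (fun x : ℝ => log ((⌊x⌋₊ : ℝ) / x)) atTop (𝓝 0) := by
    have := (continuousAt_log one_ne_zero).tendsto.comp (tendsto_nat_floor_div_atTop (R := ℝ))
    rwa [log_one] at this
  have h2 : Tendsto (fun x : ℝ => (log ⌊x⌋₊)⁻¹) atTop (𝓝 0) :=
    tendsto_inv_atTop_zero.comp (tendsto_log_atTop.comp
      (tendsto_natCast_atTop_atTop.comp tendsto_nat_floor_atTop))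
  have h3 := tendsto_const_nhds (x := (1 : ℝ)).sub (h1.mul h2)
  rw [mul_zero, sub_zero] at h3
  refine h3.congr' ?_
  filter_upwards [eventually_ge_atTop 2] with x hx
  have hf : (2 : ℝ) ≤ ⌊x⌋₊ := by 
    exact_mod_cast Nat.le_floor (by exact_mod_cast hx : ((2 : ℕ) : ℝ) ≤ x)
  have hl : 0 < log ⌊x⌋₊ := log_pos (by linarith)
  rw [log_div (by linarith) (by linarith)]
  field_simp
  ring

theorem tendsto_cntF : Tendsto (fun x : ℝ =>
    (cntF (monochromatic (greedyColor h)) x : ℝ) * log x ^ (1 - 1 / h : ℝ) / x) atTop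
      (𝓝 (h / Gamma (1 / h))) := by
  have h1 := (tendsto_cntF_natCast (h := h)).comp (tendsto_nat_floor_atTop (α := ℝ))
  have h2 := (tendsto_log_div_log_floor.rpow_const (p := (1 - 1 / h : ℝ)) (Or.inl one_ne_zero)).mul
    (tendsto_nat_floor_div_atTop (R := ℝ))
  have h3 := h1.mul h2
  rw [one_rpow, mul_one, mul_one] at h3
  refine h3.congr' ?_
  filter_upwards [eventually_ge_atTop 2] with x hx
  have hf : (2 : ℝ) ≤ ⌊x⌋₊ := by 
    exact_mod_cast Nat.le_floor (by exact_mod_cast hx : ((2 : ℕ) : ℝ) ≤ x)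
  have hl : 0 < log ⌊x⌋₊ := log_pos (by linarith)
  have hlx : 0 < log x := log_pos (by linarith)
  have e : cntF (monochromatic (greedyColor h)) (⌊x⌋₊ : ℝ) =
      cntF (monochromatic (greedyColor h)) x := by rw [cntF, cntF, Nat.floor_natCast]
  simp only [Function.comp]
  rw [e, div_rpow hlx.le hl.le]
  have := (rpow_pos_of_pos hl (1 - 1 / h : ℝ)).ne'
  field_simp

end Basis

theorem stmt7 (h : ℕ) (hh : 1 ≤ h) :
    ∃ A : Set ℕ, 0 ∉ A ∧ IsMB h A ∧
      Filter.limsup (fun x : ℝ =>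
          (((cntF A x : ℝ) * Real.log x ^ (1 - 1 / (h : ℝ)) / x : ℝ) : EReal))
        Filter.atTop = (((h : ℝ) / Real.Gamma (1 / h) : ℝ) : EReal) := by
  have : NeZero h := ⟨by omega⟩
  refine ⟨monochromatic (greedyColor h), ?_, isMB_monochromatic _, ?_⟩
  · rintro ⟨i, hi⟩
    exact ((colorInd_eq_one_iff _ i).1 hi).1 rfl
  · exact ((continuous_coe_real_ereal.tendsto _).comp tendsto_cntF).limsup_eq
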